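/- Let K be a miserly domain centered at the origin. Then no segment of the boundary of K is parametrized by a multi-curve of rank three: there is no multi-curve σ on [t₀,t₁] (t₀ < t₁) such that each σ_j is a C² regular injective curve mapping into the boundary of K and such that the curvature is nonzero for every curve, i.e., σ_j′(t) ∧ σ_j″(t) ≠ 0 for all j ∈ ℤ/6ℤ and all t ∈ (t₀,t₁). -/

import Mathlib

open MeasureTheory

noncomputable section

/-- The wedge (cross) product of two planar vectors. -/
def wedge (v w : ℝ × ℝ) : ℝ := v.1 * w.2 - v.2 * w.1

/-- A centrally symmetric convex domain in the plane. -/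
def IsCSCD (K : Set (ℝ × ℝ)) : Prop :=
  Convex ℝ K ∧ IsCompact K ∧ (interior K).Nonempty ∧ K = -K

/-- The lattice spanned over `ℤ` by the vectors `v` and `w`. -/
def latticeOf (v w : ℝ × ℝ) : Set (ℝ × ℝ) :=
  {p | ∃ m n : ℤ, p = (m : ℝ) • v + (n : ℝ) • w}

/-- `Λ + K` is a packing of `K`. -/
def IsPacking (K Λ : Set (ℝ × ℝ)) : Prop :=
  ∀ p ∈ Λ, ∀ q ∈ Λ, p ≠ q →
    interior ((fun x => p + x) '' K) ∩ interior ((fun x => q + x) '' K) = ∅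

/-- The set of densities of lattice packings of `K`. -/
def packingDensities (K : Set (ℝ × ℝ)) : Set ℝ :=
  {d | ∃ v w : ℝ × ℝ, wedge v w ≠ 0 ∧ IsPacking K (latticeOf v w) ∧
       d = (volume K).toReal / |wedge v w|}

/-- `δ_lat(K)`: the supremum of densities of lattice packings of `K`. -/
def deltaLat (K : Set (ℝ × ℝ)) : ℝ := sSup (packingDensities K)

/-- A miserly domain: a centrally symmetric convex domain minimizing `δ_lat`. -/
def IsMiserly (K : Set (ℝ × ℝ)) : Prop :=
  IsCSCD K ∧ ∀ K' : Set (ℝ × ℝ), IsCSCD K' → deltaLat K ≤ deltaLat K'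

/-- A multi-point. -/
def IsMultiPoint (u : ZMod 6 → ℝ × ℝ) : Prop :=
  ∀ j, u j + u (j + 2) + u (j + 4) = 0 ∧ u (j + 3) = -u j ∧
    wedge (u j) (u (j + 2)) = Real.sqrt 3 / 2

/-- A multi-curve on `[t₀, t₁]`. -/
def IsMultiCurve (σ : ZMod 6 → ℝ → ℝ × ℝ) (t₀ t₁ : ℝ) : Prop :=
  (∀ j, ContDiffOn ℝ 1 (σ j) (Set.Icc t₀ t₁)) ∧
  (∀ t ∈ Set.Icc t₀ t₁, IsMultiPoint (fun j => σ j t))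

theorem IsCSCD.neg_mem {K : Set (ℝ × ℝ)} (hK : IsCSCD K) {p : ℝ × ℝ} (hp : p ∈ K) : -p ∈ K := by
  have h := hK.2.2.2
  rw [h] at hp
  exact hp

theorem IsCSCD.neg_mem_interior {K : Set (ℝ × ℝ)} (hK : IsCSCD K) {p : ℝ × ℝ}
    (hp : p ∈ interior K) : -p ∈ interior K := by
  rw [mem_interior] at hp ⊢
  obtain ⟨t, ht, hto, hpt⟩ := hp
  refine ⟨-t, fun x hx => ?_, hto.neg, by simpa using hpt⟩
  have := hK.neg_mem (ht hx)
  simpa using this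

theorem IsCSCD.zero_mem_interior {K : Set (ℝ × ℝ)} (hK : IsCSCD K) : (0 : ℝ × ℝ) ∈ interior K := by
  obtain ⟨x, hx⟩ := hK.2.2.1
  have h := hK.1.combo_interior_self_mem_interior hx
    (interior_subset (hK.neg_mem_interior hx)) (a := 1 / 2) (b := 1 / 2)
    (by norm_num) (by norm_num) (by norm_num)
  simpa using h

/-- A subconvex combination with positive weight on an interior point is interior. -/
theorem subconvex_mem_interior {K : Set (ℝ × ℝ)} (hc : Convex ℝ K)
    (h0 : (0 : ℝ × ℝ) ∈ interior K) {z q : ℝ × ℝ} (hz : z ∈ interior K) (hq : q ∈ K) {s t : ℝ}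
    (hs : 0 < s) (ht : 0 ≤ t) (hst : s + t ≤ 1) : s • z + t • q ∈ interior K := by
  rcases eq_or_lt_of_le (show s ≤ 1 by linarith) with h | h
  · have : t = 0 := by linarith
    subst h this
    simpa using hz
  · have hq' : (t / (1 - s)) • q ∈ K := by
      have := hc (interior_subset h0) hq (a := 1 - t / (1 - s)) (b := t / (1 - s))
        (by rw [sub_nonneg, div_le_one (by linarith)]; linarith)
        (div_nonneg ht (by linarith)) (by ring)
      simpa using this
    have := hc.combo_interior_self_mem_interior hz hq' (a := s) (b := 1 - s) hs (by linarith)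
      (by ring)
    rwa [smul_smul, mul_div_cancel₀ _ (by linarith)] at this

theorem smul_mem_interior {K : Set (ℝ × ℝ)} (hc : Convex ℝ K)
    (h0 : (0 : ℝ × ℝ) ∈ interior K) {q : ℝ × ℝ} (hq : q ∈ K) {t : ℝ} (ht : 0 ≤ t) (ht1 : t < 1) :
    t • q ∈ interior K := by
  simpa using subconvex_mem_interior hc h0 h0 hq (s := 1 - t) (by linarith) ht (by linarith)

theorem wedge_smul_left (r : ℝ) (v w : ℝ × ℝ) : wedge (r • v) w = r * wedge v w := by
  simp [wedge]; ring

theorem wedge_smul_right (r : ℝ) (v w : ℝ × ℝ) : wedge v (r • w) = r * wedge v w := by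
  simp [wedge]; ring

theorem wedge_add_left (u v w : ℝ × ℝ) : wedge (u + v) w = wedge u w + wedge v w := by
  simp [wedge]; ring

theorem wedge_add_right (u v w : ℝ × ℝ) : wedge u (v + w) = wedge u v + wedge u w := by
  simp [wedge]; ring

theorem wedge_sub_left (u v w : ℝ × ℝ) : wedge (u - v) w = wedge u w - wedge v w := by
  simp [wedge]; ring

theorem wedge_sub_right (u v w : ℝ × ℝ) : wedge u (v - w) = wedge u v - wedge u w := by
  simp [wedge]; ring

theorem wedge_neg_left (v w : ℝ × ℝ) : wedge (-v) w = -wedge v w := by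
  simp [wedge]; ring

theorem wedge_neg_right (v w : ℝ × ℝ) : wedge v (-w) = -wedge v w := by
  simp [wedge]; ring

theorem wedge_self (v : ℝ × ℝ) : wedge v v = 0 := by
  simp [wedge]; ring

theorem wedge_swap (v w : ℝ × ℝ) : wedge v w = -wedge w v := by
  simp [wedge]; ring

theorem exists_eq_smul_of_wedge_eq_zero {u p : ℝ × ℝ} (hu : u ≠ 0) (h : wedge u p = 0) :
    ∃ x : ℝ, p = x • u := by
  unfold wedge at h
  by_cases h1 : u.1 = 0
  · have h2 : u.2 ≠ 0 := fun h2 => hu (Prod.ext h1 h2)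
    refine ⟨p.2 / u.2, Prod.ext ?_ ?_⟩
    · have : p.1 = 0 := by
        rw [h1] at h
        have : u.2 * p.1 = 0 := by linarith
        exact (mul_eq_zero.1 this).resolve_left h2
      simp [this, h1]
    · simp [h2]
  · refine ⟨p.1 / u.1, Prod.ext ?_ ?_⟩
    · simp [h1]
    · simp only [Prod.smul_snd, smul_eq_mul]
      field_simp
      linarith

theorem left_ne_zero_of_wedge_ne_zero {u p : ℝ × ℝ} (h : wedge u p ≠ 0) : u ≠ 0 := by
  rintro rfl
  simp [wedge] at h

theorem continuous_wedge : Continuous fun q : (ℝ × ℝ) × (ℝ × ℝ) => wedge q.1 q.2 := by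
  unfold wedge; fun_prop

theorem Continuous.wedge {X : Type*} [TopologicalSpace X] {f g : X → ℝ × ℝ} (hf : Continuous f)
    (hg : Continuous g) : Continuous fun x => wedge (f x) (g x) :=
  continuous_wedge.comp (hf.prodMk hg)

/-- The lattice with basis `v, w` has no nonzero point in the interior of `K`. -/
def Admissible (K : Set (ℝ × ℝ)) (v w : ℝ × ℝ) : Prop :=
  wedge v w ≠ 0 ∧ ∀ m n : ℤ, (m ≠ 0 ∨ n ≠ 0) → (m : ℝ) • v + (n : ℝ) • w ∉ interior K

theorem interior_image_add (K : Set (ℝ × ℝ)) (p : ℝ × ℝ) :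
    interior ((fun x => p + x) '' K) = (fun x => p + x) '' interior K :=
  ((Homeomorph.addLeft p).image_interior K).symm

theorem coord_eq_zero_of_wedge_ne_zero {v w : ℝ × ℝ} (h : wedge v w ≠ 0) {m n : ℝ}
    (hmn : m • v + n • w = 0) : m = 0 ∧ n = 0 := by
  have h1 : wedge (m • v + n • w) w = 0 := by rw [hmn]; simp [wedge]
  have h2 : wedge v (m • v + n • w) = 0 := by rw [hmn]; simp [wedge]
  rw [wedge_add_left, wedge_smul_left, wedge_smul_left, wedge_self] at h1
  rw [wedge_add_right, wedge_smul_right, wedge_smul_right, wedge_self] at h2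
  constructor
  · exact (mul_eq_zero.1 (by linarith)).resolve_right h
  · exact (mul_eq_zero.1 (by linarith)).resolve_right h

theorem IsCSCD.isPacking_iff {K : Set (ℝ × ℝ)} (hK : IsCSCD K) {v w : ℝ × ℝ}
    (hvw : wedge v w ≠ 0) :
    IsPacking K (latticeOf ((2 : ℝ) • v) ((2 : ℝ) • w)) ↔ Admissible K v w := by
  constructor
  · intro h
    refine ⟨hvw, fun m n hmn hz => ?_⟩
    set z := (m : ℝ) • v + (n : ℝ) • w with hzdef
    have h2z : (2 : ℝ) • z ≠ 0 := by
      intro h0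
      have hz0 : z = 0 := by simpa using h0
      have := coord_eq_zero_of_wedge_ne_zero hvw (hzdef.symm.trans hz0)
      norm_cast at this
      tauto
    have := h ((2 : ℝ) • z) ⟨m, n, by rw [hzdef]; module⟩ 0 ⟨0, 0, by simp⟩ h2z
    rw [interior_image_add, interior_image_add] at this
    have hmem : z ∈ (fun x => (2 : ℝ) • z + x) '' interior K ∩ (fun x => 0 + x) '' interior K :=
      ⟨⟨-z, hK.neg_mem_interior hz, by simp only; module⟩, ⟨z, hz, by simp⟩⟩
    rw [this] at hmem
    exact hmem
  · rintro ⟨-, h⟩ p ⟨m, n, rfl⟩ q ⟨m', n', rfl⟩ hpq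
    rw [interior_image_add, interior_image_add, Set.eq_empty_iff_forall_notMem]
    rintro z ⟨⟨x, hx, rfl⟩, ⟨y, hy, hxy⟩⟩
    refine h (m - m') (n - n') ?_ ?_
    · by_contra hc
      push Not at hc
      apply hpq
      rw [sub_eq_zero.1 hc.1, sub_eq_zero.1 hc.2]
    · have h1 := hK.1.combo_interior_self_mem_interior hy
        (interior_subset (hK.neg_mem_interior hx)) (a := 1 / 2) (b := 1 / 2)
        (by norm_num) (by norm_num) (by norm_num)
      convert h1 using 1
      simp only at hxy
      have : y = ((m : ℝ) • (2 : ℝ) • v + (n : ℝ) • (2 : ℝ) • w + x)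
          - ((m' : ℝ) • (2 : ℝ) • v + (n' : ℝ) • (2 : ℝ) • w) := by rw [← hxy]; abel
      rw [this]
      push_cast
      module

theorem IsCSCD.mem_packingDensities_iff {K : Set (ℝ × ℝ)} (hK : IsCSCD K) {d : ℝ} :
    d ∈ packingDensities K ↔
      ∃ v w, Admissible K v w ∧ d = (volume K).toReal / (4 * |wedge v w|) := by
  constructor
  · rintro ⟨v, w, hvw, hp, rfl⟩
    have hw : wedge v w = 4 * wedge ((1 / 2 : ℝ) • v) ((1 / 2 : ℝ) • w) := by
      rw [wedge_smul_left, wedge_smul_right]; ring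
    refine ⟨(1 / 2 : ℝ) • v, (1 / 2 : ℝ) • w, ?_, ?_⟩
    · rw [← hK.isPacking_iff]
      · convert hp using 2 <;> module
      · intro h0; apply hvw; rw [hw, h0]; simp
    · rw [hw, abs_mul]; norm_num
  · rintro ⟨v, w, had, rfl⟩
    have hw : wedge ((2 : ℝ) • v) ((2 : ℝ) • w) = 4 * wedge v w := by
      rw [wedge_smul_left, wedge_smul_right]; ring
    refine ⟨(2 : ℝ) • v, (2 : ℝ) • w, ?_, (hK.isPacking_iff had.1).2 had, ?_⟩
    · rw [hw]; exact mul_ne_zero (by norm_num) had.1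
    · rw [hw, abs_mul]; norm_num

theorem mem_segment_line {K : Set (ℝ × ℝ)} (hc : Convex ℝ K) {p u : ℝ × ℝ}
    (h0 : p ∈ interior K) (h1 : p + u ∈ interior K) {x : ℝ} (hx : 0 ≤ x) (hx1 : x ≤ 1) :
    p + x • u ∈ interior K := by
  have := hc.interior h0 h1 (a := 1 - x) (b := x) (by linarith) hx (by ring)
  convert this using 1
  module

/-- Below the height of the chord from `p` to `p + u`, the body contains an interior translate of
that chord at every height. -/
theorem IsCSCD.exists_interior_chord {K : Set (ℝ × ℝ)} (hK : IsCSCD K) {u p q : ℝ × ℝ}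
    (hu : u ∈ K) (hp : p ∈ K) (hpu : p + u ∈ K) (hq : 0 < wedge u q)
    (hqp : wedge u q < wedge u p) :
    ∃ x : ℝ, q + x • u ∈ interior K ∧ q + (x + 1) • u ∈ interior K := by
  have hu0 : u ≠ 0 := left_ne_zero_of_wedge_ne_zero hq.ne'
  set τ := wedge u q / wedge u p
  have hτ0 : 0 < τ := div_pos hq (hq.trans hqp)
  have hτ1 : τ < 1 := (div_lt_one (hq.trans hqp)).2 hqp
  have h0 := hK.zero_mem_interior
  have hw : wedge u (τ • p + (1 - τ) • (-(1 / 2 : ℝ) • u) - q) = 0 := by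
    rw [wedge_sub_right, wedge_add_right, wedge_smul_right, wedge_smul_right, wedge_smul_right,
      wedge_self]
    have : τ * wedge u p = wedge u q := div_mul_cancel₀ _ (hq.trans hqp).ne'
    linarith
  obtain ⟨x, hx⟩ := exists_eq_smul_of_wedge_eq_zero hu0 hw
  have hu2 : (1 / 2 : ℝ) • u ∈ interior K :=
    smul_mem_interior hK.1 h0 hu (by norm_num) (by norm_num)
  have hu2' := hK.neg_mem_interior hu2
  refine ⟨x, ?_, ?_⟩
  · have := hK.1.combo_interior_self_mem_interior hu2' hp (a := 1 - τ) (b := τ) (by linarith)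
      hτ0.le (by ring)
    convert this using 1
    rw [← hx]; module
  · have := hK.1.combo_interior_self_mem_interior hu2 hpu (a := 1 - τ) (b := τ) (by linarith)
      hτ0.le (by ring)
    convert this using 1
    rw [add_smul, ← hx]; module

theorem notMem_interior_of_mem_frontier {K : Set (ℝ × ℝ)} {p : ℝ × ℝ} (hp : p ∈ frontier K) :
    p ∉ interior K := by
  intro h
  rw [frontier] at hp
  exact hp.2 h

/-- An inscribed affine regular hexagon has determinant at least that of any
hexagon of points of `K` sharing a vertex. -/
theorem IsCSCD.wedge_le_of_hexagon {K : Set (ℝ × ℝ)} (hK : IsCSCD K) {u p q : ℝ × ℝ}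
    (hu : u ∈ K) (hp : p ∈ K) (hpu : p + u ∈ K) (hq : q ∈ frontier K) (hqu : q + u ∈ frontier K)
    (hw : 0 < wedge u q) : wedge u p ≤ wedge u q := by
  by_contra! hlt
  obtain ⟨x, hx0, hx1⟩ := hK.exists_interior_chord hu hp hpu hw hlt
  have hcl := hK.2.1.isClosed
  have hqK := hcl.frontier_subset hq
  have hquK := hcl.frontier_subset hqu
  have hqi := notMem_interior_of_mem_frontier hq
  have hqui := notMem_interior_of_mem_frontier hqu
  rcases le_total 0 x with h | h
  · apply hqui
    have h1 : (0 : ℝ) < x + 1 := by linarith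
    have := hK.1.combo_interior_self_mem_interior hx1 hqK (a := 1 / (x + 1)) (b := x / (x + 1))
      (by positivity) (by positivity) (by field_simp; ring)
    convert this using 1
    match_scalars <;> field_simp
    ring
  · apply hqi
    have h1 : (0 : ℝ) < 1 - x := by linarith
    have := hK.1.combo_interior_self_mem_interior hx0 hquK (a := 1 / (1 - x)) (b := -x / (1 - x))
      (by positivity) (div_nonneg (by linarith) h1.le) (by field_simp; ring)
    convert this using 1
    match_scalars <;> field_simp <;> ring

/-- Vertices of an inscribed affine regular hexagon span an admissible lattice. -/
theorem IsCSCD.admissible_of_hexagon {K : Set (ℝ × ℝ)} (hK : IsCSCD K) {u a : ℝ × ℝ}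
    (hu : u ∈ frontier K) (ha : a ∈ frontier K) (hua : a + u ∈ frontier K)
    (hw : wedge u a ≠ 0) : Admissible K u a := by
  refine ⟨hw, fun m n hmn hz => ?_⟩
  have hcl := hK.2.1.isClosed
  have h0 := hK.zero_mem_interior
  have huK := hcl.frontier_subset hu
  have haK := hcl.frontier_subset ha
  have hbK := hcl.frontier_subset hua
  have hsgn : ∀ (k : ℤ) (q : ℝ × ℝ), q ∈ K → ∃ q' ∈ K, (k : ℝ) • q = |(k : ℝ)| • q' := by
    intro k q hq
    rcases abs_cases (k : ℝ) with ⟨h, -⟩ | ⟨h, -⟩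
    · exact ⟨q, hq, by rw [h]⟩
    · exact ⟨-q, hK.neg_mem hq, by rw [h]; module⟩
  have hsgn' : ∀ (k : ℤ) (q : ℝ × ℝ), k ≠ 0 → (1 / (k : ℝ)) • q ∈ interior K →
      (1 / |(k : ℝ)|) • q ∈ interior K := by
    intro k q hk hq
    rcases abs_cases (k : ℝ) with ⟨h, -⟩ | ⟨h, -⟩
    · rwa [h]
    · rw [h]
      convert hK.neg_mem_interior hq using 1
      rw [div_neg]; module
  -- a dominant coefficient forces the corresponding vertex to be interior
  have key : ∀ (k l : ℤ) (x y : ℝ × ℝ), x ∈ frontier K → y ∈ K → |l| < |k| →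
      (k : ℝ) • x + (l : ℝ) • y ∈ interior K → False := by
    intro k l x y hx hy hlk hkl
    have hk0 : (0 : ℝ) < |(k : ℝ)| := by
      have : (0 : ℤ) < |k| := lt_of_le_of_lt (abs_nonneg l) hlk
      exact_mod_cast this
    have hlk' : |(l : ℝ)| + 1 ≤ |(k : ℝ)| := by exact_mod_cast hlk
    have hkne : (k : ℝ) ≠ 0 := abs_pos.1 hk0
    obtain ⟨y', hy', hyy⟩ := hsgn (-l) y hy
    have h1 := subconvex_mem_interior hK.1 h0 hkl hy' (s := 1 / |(k : ℝ)|)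
      (t := |(l : ℝ)| / |(k : ℝ)|) (by positivity) (by positivity)
      (by rw [← add_div, div_le_one hk0]; linarith)
    have h2 : (1 / |(k : ℝ)|) • ((k : ℝ) • x + (l : ℝ) • y) + (|(l : ℝ)| / |(k : ℝ)|) • y'
        = ((k : ℝ) / |(k : ℝ)|) • x := by
      have : |(l : ℝ)| • y' = -((l : ℝ) • y) := by
        rw [Int.cast_neg, abs_neg] at hyy
        rw [← hyy]; module
      rw [show (|(l : ℝ)| / |(k : ℝ)|) • y' = (1 / |(k : ℝ)|) • (|(l : ℝ)| • y') by
        rw [smul_smul]; ring_nf, this]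
      module
    rw [h2] at h1
    apply notMem_interior_of_mem_frontier hx
    rcases abs_cases (k : ℝ) with ⟨h, -⟩ | ⟨h, -⟩
    · rw [h, div_self hkne, one_smul] at h1; exact h1
    · rw [h, div_neg, div_self hkne] at h1
      simpa using hK.neg_mem_interior h1
  rcases lt_trichotomy |m| |n| with h | h | h
  · exact key n m a u ha huK h (by rwa [add_comm])
  · rcases abs_eq_abs.1 h with h | h
    · subst h
      have hm : m ≠ 0 := by tauto
      exact key m 0 (a + u) 0 hua (interior_subset h0) (by simpa using hm)
        (by convert hz using 1; simp only [Int.cast_zero]; module)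
    · have hn : n ≠ 0 := by
        rintro rfl
        simp at h
        tauto
      have hnr : (n : ℝ) ≠ 0 := by exact_mod_cast hn
      have h1 : (1 : ℝ) ≤ |(n : ℝ)| := by exact_mod_cast Int.one_le_abs hn
      have h2 : u - a ∈ interior K := by
        have h4 : (1 / |(n : ℝ)|) • ((m : ℝ) • u + (n : ℝ) • a) ∈ interior K := by
          simpa using subconvex_mem_interior hK.1 h0 hz (interior_subset h0)
            (s := 1 / |(n : ℝ)|) (t := 0) (by positivity) le_rfl
            (by rw [add_zero, div_le_one (by positivity)]; exact h1)
        rw [h] at h4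
        rcases abs_cases (n : ℝ) with ⟨h', -⟩ | ⟨h', -⟩
        · rw [h'] at h4
          convert hK.neg_mem_interior h4 using 1
          push_cast
          match_scalars <;> field_simp
        · rw [h'] at h4
          convert h4 using 1
          push_cast
          match_scalars <;> field_simp
      have h5 := hK.1.combo_interior_self_mem_interior h2 hbK (a := 1 / 2) (b := 1 / 2)
        (by norm_num) (by norm_num) (by norm_num)
      apply notMem_interior_of_mem_frontier hu
      convert h5 using 1
      module
  · exact key m n u a hu haK h hz

theorem abs_wedge_le (v w : ℝ × ℝ) : |wedge v w| ≤ 2 * ‖v‖ * ‖w‖ := by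
  have h1 := norm_fst_le v
  have h2 := norm_snd_le v
  have h3 := norm_fst_le w
  have h4 := norm_snd_le w
  unfold wedge
  calc |v.1 * w.2 - v.2 * w.1| ≤ |v.1 * w.2| + |v.2 * w.1| := abs_sub _ _
    _ = ‖v.1‖ * ‖w.2‖ + ‖v.2‖ * ‖w.1‖ := by simp [abs_mul]
    _ ≤ ‖v‖ * ‖w‖ + ‖v‖ * ‖w‖ := by gcongr
    _ = _ := by ring

theorem IsCSCD.finite_lattice_gauge_le {K : Set (ℝ × ℝ)} (hK : IsCSCD K) {v w : ℝ × ℝ}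
    (hvw : wedge v w ≠ 0) (N : ℝ) :
    {x : ℤ × ℤ | gauge K ((x.1 : ℝ) • v + (x.2 : ℝ) • w) ≤ N}.Finite := by
  have hnhds : K ∈ nhds (0 : ℝ × ℝ) := mem_interior_iff_mem_nhds.1 hK.zero_mem_interior
  obtain ⟨R, hR0, hR⟩ := hK.2.1.isBounded.subset_closedBall_lt 0 0
  have habs : Absorbent ℝ K := absorbent_nhds_zero hnhds
  have hvw' : 0 < |wedge v w| := abs_pos.2 hvw
  set C := 2 * (N * R) * (‖v‖ + ‖w‖) / |wedge v w|
  have hb : ∀ x : ℤ × ℤ, gauge K ((x.1 : ℝ) • v + (x.2 : ℝ) • w) ≤ N →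
      |(x.1 : ℝ)| ≤ C ∧ |(x.2 : ℝ)| ≤ C := by
    intro x hx
    set z := (x.1 : ℝ) • v + (x.2 : ℝ) • w with hz
    have hzn : ‖z‖ ≤ N * R := by
      have := (le_gauge_of_subset_closedBall habs hR0.le hR (x := z)).trans hx
      rwa [div_le_iff₀ hR0] at this
    have hv := norm_nonneg v
    have hw := norm_nonneg w
    have hzz := norm_nonneg z
    constructor
    · rw [le_div_iff₀ hvw', ← abs_mul]
      have : (x.1 : ℝ) * wedge v w = wedge z w := by
        rw [hz, wedge_add_left, wedge_smul_left, wedge_smul_left, wedge_self]; ring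
      rw [this]
      refine (abs_wedge_le z w).trans ?_
      gcongr <;> linarith
    · rw [le_div_iff₀ hvw', ← abs_mul]
      have : (x.2 : ℝ) * wedge v w = -wedge z v := by
        rw [hz, wedge_add_left, wedge_smul_left, wedge_smul_left, wedge_self, wedge_swap w v]; ring
      rw [this, abs_neg]
      refine (abs_wedge_le z v).trans ?_
      gcongr <;> linarith
  refine (((Set.finite_Icc (-⌈C⌉) ⌈C⌉).prod (Set.finite_Icc (-⌈C⌉) ⌈C⌉))).subset ?_
  intro x hx
  obtain ⟨h1, h2⟩ := hb x hx
  have key : ∀ m : ℤ, |(m : ℝ)| ≤ C → m ∈ Set.Icc (-⌈C⌉) ⌈C⌉ := by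
    intro m hm
    have : ((|m| : ℤ) : ℝ) ≤ (⌈C⌉ : ℝ) := by
      push_cast
      exact hm.trans (Int.le_ceil C)
    have : |m| ≤ ⌈C⌉ := by exact_mod_cast this
    exact abs_le.1 this
  exact ⟨key _ h1, key _ h2⟩

/-- Rescaling an admissible lattice so that a shortest vector is on the boundary. -/
theorem IsCSCD.exists_row {K : Set (ℝ × ℝ)} (hK : IsCSCD K) {v w : ℝ × ℝ}
    (h : Admissible K v w) :
    ∃ u ∈ frontier K, ∃ q, 0 < wedge u q ∧ wedge u q ≤ |wedge v w| ∧
      ∀ k : ℤ, q + (k : ℝ) • u ∉ interior K := by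
  have hnhds : K ∈ nhds (0 : ℝ × ℝ) := mem_interior_iff_mem_nhds.1 hK.zero_mem_interior
  set f : ℤ × ℤ → ℝ := fun x => gauge K ((x.1 : ℝ) • v + (x.2 : ℝ) • w) with hf
  obtain ⟨⟨m, n⟩, ⟨hmn, -⟩, hmin'⟩ := Set.exists_min_image
    {x : ℤ × ℤ | (x.1 ≠ 0 ∨ x.2 ≠ 0) ∧ f x ≤ f (1, 0)} f
    ((hK.finite_lattice_gauge_le h.1 (f (1, 0))).subset fun x hx => hx.2)
    ⟨(1, 0), by simp⟩
  have hmin : ∀ k l : ℤ, (k ≠ 0 ∨ l ≠ 0) → f (m, n) ≤ f (k, l) := by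
    intro k l hkl
    rcases le_total (f (k, l)) (f (1, 0)) with h1 | h1
    · exact hmin' (k, l) ⟨hkl, h1⟩
    · exact (hmin' (1, 0) ⟨by simp, le_rfl⟩).trans h1
  simp only at hmn
  set ρ := f (m, n) with hρ
  have hρ1 : 1 ≤ ρ := by
    by_contra! hlt
    exact h.2 m n hmn ((gauge_lt_one_iff_mem_interior hK.1 hnhds).1 hlt)
  have hρ0 : 0 < ρ := by linarith
  have hcop : IsCoprime m n := by
    rw [Int.isCoprime_iff_gcd_eq_one]
    by_contra hg
    have hgpos : 0 < Int.gcd m n := Int.gcd_pos_iff.2 hmn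
    have hg2 : 2 ≤ Int.gcd m n := by omega
    obtain ⟨m', hm'⟩ := Int.gcd_dvd_left (a := m) (b := n)
    obtain ⟨n', hn'⟩ := Int.gcd_dvd_right (a := m) (b := n)
    set g := Int.gcd m n
    have hne : m' ≠ 0 ∨ n' ≠ 0 := by
      by_contra hc
      push Not at hc
      rw [hc.1] at hm'
      rw [hc.2] at hn'
      simp at hm' hn'
      tauto
    have h1 := hmin m' n' hne
    have h2 : ρ = g * f (m', n') := by
      have : ((m : ℝ) • v + (n : ℝ) • w) = (g : ℝ) • ((m' : ℝ) • v + (n' : ℝ) • w) := by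
        have e1 : (m : ℝ) = (g : ℝ) * (m' : ℝ) := by exact_mod_cast hm'
        have e2 : (n : ℝ) = (g : ℝ) * (n' : ℝ) := by exact_mod_cast hn'
        rw [e1, e2]; module
      rw [hρ, hf]
      simp only
      rw [this, gauge_smul_of_nonneg (by positivity), smul_eq_mul]
    have h3 : (2 : ℝ) ≤ g := by exact_mod_cast hg2
    nlinarith
  obtain ⟨k, l, hkl⟩ := hcop
  set z := (m : ℝ) • v + (n : ℝ) • w with hz
  have hz' : gauge K z = ρ := rfl
  have hu : ρ⁻¹ • z ∈ frontier K := by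
    rw [← gauge_eq_one_iff_mem_frontier hK.1 hnhds, gauge_smul_of_nonneg (by positivity), hz',
      smul_eq_mul, inv_mul_cancel₀ hρ0.ne']
  have hnot : ∀ i j : ℤ, (i ≠ 0 ∨ j ≠ 0) → ρ⁻¹ • ((i : ℝ) • v + (j : ℝ) • w) ∉ interior K := by
    intro i j hij
    rw [← gauge_lt_one_iff_mem_interior hK.1 hnhds, gauge_smul_of_nonneg (by positivity),
      smul_eq_mul, not_lt]
    have := hmin i j hij
    rw [← div_eq_inv_mul, le_div_iff₀ hρ0]
    simpa using this
  have hkl' : (k : ℝ) * m + l * n = 1 := by exact_mod_cast hkl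
  have hwz : wedge z (-(l : ℝ) • v + (k : ℝ) • w) = wedge v w := by
    rw [hz, wedge_add_left, wedge_add_right, wedge_add_right]
    simp only [wedge_smul_left, wedge_smul_right, wedge_self]
    rw [wedge_swap w v]
    linear_combination (wedge v w) * hkl'
  have key : ∀ s : ℤ, (s = 1 ∨ s = -1) → 0 < s * wedge v w →
      ∃ u ∈ frontier K, ∃ q, 0 < wedge u q ∧ wedge u q ≤ |wedge v w| ∧
      ∀ k : ℤ, q + (k : ℝ) • u ∉ interior K := by
    intro s hs hpos
    have hs' : |(s : ℝ)| = 1 := by rcases hs with rfl | rfl <;> simp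
    have hval : wedge (ρ⁻¹ • z) (ρ⁻¹ • (s : ℝ) • (-(l : ℝ) • v + (k : ℝ) • w)) =
        ρ⁻¹ * (ρ⁻¹ * (s * wedge v w)) := by
      rw [wedge_smul_left, wedge_smul_right, wedge_smul_right, hwz]
    refine ⟨_, hu, ρ⁻¹ • (s : ℝ) • (-(l : ℝ) • v + (k : ℝ) • w), ?_, ?_, ?_⟩
    · rw [hval]; positivity
    · rw [hval]
      have h1 : s * wedge v w = |wedge v w| := by
        rw [← abs_of_pos hpos, abs_mul, hs', one_mul]
      rw [h1]
      have h2 : ρ⁻¹ ≤ 1 := inv_le_one_of_one_le₀ hρ1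
      have h3 : 0 ≤ ρ⁻¹ := by positivity
      have h4 := abs_nonneg (wedge v w)
      nlinarith [mul_le_mul h2 h2 h3 zero_le_one]
    · intro i
      have := hnot (-s * l + i * m) (s * k + i * n) ?_
      · convert this using 2
        push_cast
        rw [hz]; module
      · by_contra hc
        push Not at hc
        have : s * (k * m + l * n) = 0 := by linear_combination m * hc.2 - n * hc.1
        rw [hkl] at this
        rcases hs with rfl | rfl <;> simp at this
  rcases lt_or_gt_of_ne h.1 with h1 | h1
  · exact key (-1) (by simp) (by push_cast; linarith)
  · exact key 1 (by simp) (by push_cast; linarith)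

/-- Every admissible lattice dominates an inscribed affine regular hexagon. -/
theorem IsCSCD.exists_hexagon {K : Set (ℝ × ℝ)} (hK : IsCSCD K) {v w : ℝ × ℝ}
    (h : Admissible K v w) :
    ∃ u ∈ frontier K, ∃ a ∈ frontier K, a + u ∈ frontier K ∧ 0 < wedge u a ∧
      wedge u a ≤ |wedge v w| := by
  obtain ⟨u, hu, q, hq0, hq1, hrow⟩ := hK.exists_row h
  have hcl := hK.2.1.isClosed
  have h0 := hK.zero_mem_interior
  have huK := hcl.frontier_subset hu
  have hu2 : (1 / 2 : ℝ) • u ∈ interior K :=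
    smul_mem_interior hK.1 h0 huK (by norm_num) (by norm_num)
  have hu2' := hK.neg_mem_interior hu2
  set E : Set (ℝ × ℝ) := K ∩ (fun p => p + u) ⁻¹' K
  have hE : IsCompact E := hK.2.1.inter_right (hcl.preimage (by fun_prop))
  have huE : -((1 / 2 : ℝ) • u) ∈ E := by
    refine ⟨interior_subset hu2', ?_⟩
    have : -((1 / 2 : ℝ) • u) + u = (1 / 2 : ℝ) • u := by module
    rw [Set.mem_preimage, this]
    exact interior_subset hu2
  obtain ⟨a, haE, hmax⟩ := hE.exists_isMaxOn ⟨_, huE⟩ (f := fun p => wedge u p)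
    (continuous_const.wedge continuous_id).continuousOn
  have hint : ∀ p, p ∈ interior K → p + u ∈ interior K → wedge u p < wedge u a := by
    intro p hp hpu
    have hcont1 : Filter.Tendsto (fun δ : ℝ => p + δ • q) (nhds 0) (nhds p) := by
      have : Continuous fun δ : ℝ => p + δ • q := by fun_prop
      simpa using this.tendsto 0
    have hcont2 : Filter.Tendsto (fun δ : ℝ => p + δ • q + u) (nhds 0) (nhds (p + u)) := by
      have : Continuous fun δ : ℝ => p + δ • q + u := by fun_prop
      simpa using this.tendsto 0
    have hev := (hcont1.eventually (isOpen_interior.mem_nhds hp)).and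
      (hcont2.eventually (isOpen_interior.mem_nhds hpu))
    obtain ⟨δ, ⟨h1, h2⟩, hδ⟩ :=
      ((hev.filter_mono nhdsWithin_le_nhds).and self_mem_nhdsWithin :
        ∀ᶠ δ in nhdsWithin (0 : ℝ) (Set.Ioi 0), _).exists
    have := hmax (show p + δ • q ∈ E from ⟨interior_subset h1,
      (interior_subset h2 : p + δ • q + u ∈ K)⟩)
    simp only [Set.mem_ofPred_eq, wedge_add_right, wedge_smul_right] at this
    have hδ' : (0 : ℝ) < δ := hδ
    nlinarith [mul_pos hδ' hq0]
  have hfr : ∀ {x : ℝ × ℝ}, x ∈ K → x ∉ interior K → x ∈ frontier K := fun hx hx' =>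
    ⟨subset_closure hx, hx'⟩
  have hpos : 0 < wedge u a := by
    have := hint _ hu2' (by
      have : -((1 / 2 : ℝ) • u) + u = (1 / 2 : ℝ) • u := by module
      rwa [this])
    rwa [wedge_neg_right, wedge_smul_right, wedge_self, mul_zero, neg_zero] at this
  have hne : u ≠ 0 := left_ne_zero_of_wedge_ne_zero hpos.ne'
  refine ⟨u, hu, a, hfr haE.1 ?_, hfr haE.2 ?_, hpos, ?_⟩
  · intro ha
    have hcont : Filter.Tendsto (fun δ : ℝ => a + (-δ) • u) (nhds 0) (nhds a) := by
      have : Continuous fun δ : ℝ => a + (-δ) • u := by fun_prop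
      simpa using this.tendsto 0
    have hev := (hcont.eventually (isOpen_interior.mem_nhds ha)).and
      (eventually_lt_nhds (show (0 : ℝ) < 1 by norm_num))
    obtain ⟨δ, ⟨h1, h2⟩, hδ⟩ :=
      ((hev.filter_mono nhdsWithin_le_nhds).and self_mem_nhdsWithin :
        ∀ᶠ δ in nhdsWithin (0 : ℝ) (Set.Ioi 0), _).exists
    have hδ' : (0 : ℝ) < δ := hδ
    have h3 := hK.1.combo_interior_self_mem_interior ha haE.2 (a := δ) (b := 1 - δ) hδ'
      (by linarith) (by ring)
    have := hint (a + (-δ) • u) h1 (by convert h3 using 1; module)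
    rw [wedge_add_right, wedge_smul_right, wedge_self] at this
    linarith
  · intro ha
    have hcont : Filter.Tendsto (fun δ : ℝ => a + δ • u + u) (nhds 0) (nhds (a + u)) := by
      have : Continuous fun δ : ℝ => a + δ • u + u := by fun_prop
      simpa using this.tendsto 0
    have hev := (hcont.eventually (isOpen_interior.mem_nhds ha)).and
      (eventually_lt_nhds (show (0 : ℝ) < 1 by norm_num))
    obtain ⟨δ, ⟨h1, h2⟩, hδ⟩ :=
      ((hev.filter_mono nhdsWithin_le_nhds).and self_mem_nhdsWithin :
        ∀ᶠ δ in nhdsWithin (0 : ℝ) (Set.Ioi 0), _).exists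
    have hδ' : (0 : ℝ) < δ := hδ
    have h3 := hK.1.combo_interior_self_mem_interior ha haE.1 (a := δ) (b := 1 - δ) hδ'
      (by linarith) (by ring)
    have := hint (a + δ • u) (by convert h3 using 1; module) h1
    rw [wedge_add_right, wedge_smul_right, wedge_self] at this
    linarith
  · refine le_trans ?_ hq1
    by_contra! hlt
    obtain ⟨x, hx0, hx1⟩ := hK.exists_interior_chord huK haE.1 haE.2 hq0 hlt
    apply hrow ⌈x⌉
    have := mem_segment_line hK.1 hx0
      (by convert hx1 using 1; module : q + x • u + u ∈ interior K) (x := ⌈x⌉ - x)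
      (by linarith [Int.le_ceil x]) (by linarith [Int.ceil_lt_add_one x])
    convert this using 1
    module

theorem IsCSCD.exists_wedge_lower_bound {K : Set (ℝ × ℝ)} (hK : IsCSCD K) :
    ∃ c : ℝ, 0 < c ∧ ∀ v w, Admissible K v w → c ≤ |wedge v w| := by
  obtain ⟨r, hr0, hr⟩ := Metric.isOpen_iff.1 isOpen_interior 0 hK.zero_mem_interior
  refine ⟨r ^ 2 / 4, by positivity, fun v w h => ?_⟩
  obtain ⟨u, hu, a, ha, hau, hpos, hle⟩ := hK.exists_hexagon h
  refine le_trans ?_ hle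
  have huK := hK.2.1.isClosed.frontier_subset hu
  have hru : r ≤ ‖u‖ := by
    by_contra! hlt
    exact notMem_interior_of_mem_frontier hu (hr (by simpa using hlt))
  have hu0 : 0 < ‖u‖ := by linarith
  set s := r / (4 * ‖u‖) with hs
  have hs0 : 0 < s := by positivity
  have hperp : (2 * s) • ((-u.2, u.1) : ℝ × ℝ) ∈ K := by
    apply interior_subset
    apply hr
    have : ‖((-u.2, u.1) : ℝ × ℝ)‖ = ‖u‖ := by
      rw [Prod.norm_def, Prod.norm_def, norm_neg, max_comm]
    rw [mem_ball_zero_iff, norm_smul, this, Real.norm_of_nonneg (by positivity), hs]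
    field_simp
    linarith
  have hc : Convex ℝ K := hK.1
  have h1 := hc (hK.neg_mem huK) hperp (a := 1 / 2) (b := 1 / 2) (by norm_num) (by norm_num)
    (by norm_num)
  have h2 := hc huK hperp (a := 1 / 2) (b := 1 / 2) (by norm_num) (by norm_num)
    (by norm_num)
  have h3 := hK.wedge_le_of_hexagon huK h1 (by convert h2 using 1; module) ha hau hpos
  refine le_trans ?_ h3
  have h4 : wedge u ((1 / 2 : ℝ) • -u + (1 / 2 : ℝ) • (2 * s) • ((-u.2, u.1) : ℝ × ℝ))
      = s * (u.1 ^ 2 + u.2 ^ 2) := by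
    simp [wedge]; ring
  rw [h4]
  have h5 : ‖u‖ ^ 2 ≤ u.1 ^ 2 + u.2 ^ 2 := by
    rw [Prod.norm_def]
    rcases max_cases ‖u.1‖ ‖u.2‖ with ⟨h, -⟩ | ⟨h, -⟩ <;> rw [h] <;>
      simp only [Real.norm_eq_abs, sq_abs] <;> nlinarith [sq_nonneg u.1, sq_nonneg u.2]
  calc r ^ 2 / 4 ≤ r * ‖u‖ / 4 := by nlinarith
    _ = s * ‖u‖ ^ 2 := by rw [hs]; field_simp
    _ ≤ _ := by gcongr

theorem IsCSCD.bddAbove_packingDensities {K : Set (ℝ × ℝ)} (hK : IsCSCD K) :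
    BddAbove (packingDensities K) := by
  obtain ⟨c, hc, hb⟩ := hK.exists_wedge_lower_bound
  refine ⟨(volume K).toReal / (4 * c), ?_⟩
  intro d hd
  obtain ⟨v, w, had, rfl⟩ := hK.mem_packingDensities_iff.1 hd
  have := hb v w had
  gcongr

/-- Shrinking the area without shrinking critical determinants lowers the lattice density. -/
theorem deltaLat_lt_deltaLat {K K' : Set (ℝ × ℝ)} (hK : IsCSCD K) (hK' : IsCSCD K')
    (hne : ∃ v w, Admissible K v w) (hvol : (volume K').toReal < (volume K).toReal)
    (h : ∀ v w, Admissible K' v w → ∃ v' w', Admissible K v' w' ∧ |wedge v' w'| ≤ |wedge v w|) :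
    deltaLat K' < deltaLat K := by
  have hVK : 0 < (volume K).toReal := lt_of_le_of_lt ENNReal.toReal_nonneg hvol
  have hpos : 0 < deltaLat K := by
    obtain ⟨v, w, had⟩ := hne
    have h1 := le_csSup hK.bddAbove_packingDensities (hK.mem_packingDensities_iff.2 ⟨v, w, had, rfl⟩)
    refine lt_of_lt_of_le ?_ h1
    have := abs_pos.2 had.1
    positivity
  have hle : deltaLat K' ≤ (volume K').toReal / (volume K).toReal * deltaLat K := by
    apply Real.sSup_le
    · intro d hd
      obtain ⟨v, w, had, rfl⟩ := hK'.mem_packingDensities_iff.1 hd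
      obtain ⟨v', w', had', hvw⟩ := h v w had
      have h1 := le_csSup hK.bddAbove_packingDensities
        (hK.mem_packingDensities_iff.2 ⟨v', w', had', rfl⟩)
      have h2 := abs_pos.2 had'.1
      calc (volume K').toReal / (4 * |wedge v w|) ≤ (volume K').toReal / (4 * |wedge v' w'|) := by
            gcongr
        _ = (volume K').toReal / (volume K).toReal * ((volume K).toReal / (4 * |wedge v' w'|)) := by
            field_simp
        _ ≤ _ := by
            have : 0 ≤ (volume K').toReal / (volume K).toReal := by positivity
            exact mul_le_mul_of_nonneg_left h1 this
    · positivity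
  refine hle.trans_lt ?_
  have : (volume K').toReal / (volume K).toReal < 1 := (div_lt_one hVK).2 hvol
  nlinarith

theorem HasDerivAt.wedge {f g : ℝ → ℝ × ℝ} {f' g' : ℝ × ℝ} {t : ℝ} (hf : HasDerivAt f f' t)
    (hg : HasDerivAt g g' t) :
    HasDerivAt (fun t => wedge (f t) (g t)) (wedge f' (g t) + wedge (f t) g') t := by
  have f1 : HasDerivAt (fun t => (f t).1) f'.1 t :=
    (ContinuousLinearMap.fst ℝ ℝ ℝ).hasFDerivAt.comp_hasDerivAt t hf
  have f2 : HasDerivAt (fun t => (f t).2) f'.2 t :=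
    (ContinuousLinearMap.snd ℝ ℝ ℝ).hasFDerivAt.comp_hasDerivAt t hf
  have g1 : HasDerivAt (fun t => (g t).1) g'.1 t :=
    (ContinuousLinearMap.fst ℝ ℝ ℝ).hasFDerivAt.comp_hasDerivAt t hg
  have g2 : HasDerivAt (fun t => (g t).2) g'.2 t :=
    (ContinuousLinearMap.snd ℝ ℝ ℝ).hasFDerivAt.comp_hasDerivAt t hg
  have := (f1.mul g2).sub (f2.mul g1)
  refine HasDerivAt.congr_deriv this ?_
  simp only [_root_.wedge]; ring

theorem HasDerivAt.const_wedge {g : ℝ → ℝ × ℝ} {g' : ℝ × ℝ} {t : ℝ} (v : ℝ × ℝ)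
    (hg : HasDerivAt g g' t) : HasDerivAt (fun t => _root_.wedge v (g t)) (_root_.wedge v g') t := by
  have := (hasDerivAt_const t v).wedge hg
  simpa [_root_.wedge] using this

theorem HasDerivAt.wedge_const {g : ℝ → ℝ × ℝ} {g' : ℝ × ℝ} {t : ℝ} (hg : HasDerivAt g g' t)
    (v : ℝ × ℝ) : HasDerivAt (fun t => _root_.wedge (g t) v) (_root_.wedge g' v) t := by
  have := hg.wedge (hasDerivAt_const t v)
  simpa [_root_.wedge] using this

theorem strictMonoOn_Icc_of_hasDerivAt_pos {f f' : ℝ → ℝ} {a b : ℝ}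
    (hf : ∀ t, HasDerivAt f (f' t) t) (hpos : ∀ t ∈ Set.Ioo a b, 0 < f' t) :
    StrictMonoOn f (Set.Icc a b) := by
  refine strictMonoOn_of_hasDerivWithinAt_pos (convex_Icc a b) (f' := f')
    (fun t _ => (hf t).continuousAt.continuousWithinAt) ?_ ?_
  · exact fun t _ => (hf t).hasDerivWithinAt
  · intro t ht
    rw [interior_Icc] at ht
    exact hpos t ht

/-- A curve on `[s₀, s₁]`, with its first two derivatives, that turns strictly to the left by less
than a half turn. -/
structure IsArc (g g1 g2 : ℝ → ℝ × ℝ) (s₀ s₁ : ℝ) : Prop where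
  lt : s₀ < s₁
  hasDerivAt : ∀ t, HasDerivAt g (g1 t) t
  hasDerivAt' : ∀ t, HasDerivAt g1 (g2 t) t
  pos : ∀ t ∈ Set.Icc s₀ s₁, ∀ τ ∈ Set.Icc s₀ s₁, 0 < wedge (g1 t) (g2 τ)

/-- The region between an arc and its chord. -/
def cap (g g1 : ℝ → ℝ × ℝ) (s₀ s₁ : ℝ) : Set (ℝ × ℝ) :=
  {p | 0 ≤ wedge (p - g s₀) (g s₁ - g s₀) ∧ ∀ t ∈ Set.Icc s₀ s₁, 0 ≤ wedge (g1 t) (p - g t)}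

namespace IsArc

variable {g g1 g2 : ℝ → ℝ × ℝ} {s₀ s₁ : ℝ}

theorem continuous (h : IsArc g g1 g2 s₀ s₁) : Continuous g :=
  continuous_iff_continuousAt.2 fun t => (h.hasDerivAt t).continuousAt

theorem continuous' (h : IsArc g g1 g2 s₀ s₁) : Continuous g1 :=
  continuous_iff_continuousAt.2 fun t => (h.hasDerivAt' t).continuousAt

theorem wedge_deriv_pos (h : IsArc g g1 g2 s₀ s₁) {t s : ℝ} (ht : s₀ ≤ t) (hts : t < s)
    (hs : s ≤ s₁) : 0 < wedge (g1 t) (g1 s) := by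
  have hm : StrictMonoOn (fun s => wedge (g1 t) (g1 s)) (Set.Icc s₀ s₁) :=
    strictMonoOn_Icc_of_hasDerivAt_pos (fun τ => (h.hasDerivAt' τ).const_wedge (g1 t))
      fun τ hτ => h.pos t ⟨ht, hts.le.trans hs⟩ τ ⟨hτ.1.le, hτ.2.le⟩
  have := hm ⟨ht, hts.le.trans hs⟩ ⟨ht.trans hts.le, hs⟩ hts
  simpa [wedge_self] using this

/-- An arc lies strictly on the left of its tangent lines. -/
theorem tangent_pos (h : IsArc g g1 g2 s₀ s₁) {t s : ℝ} (ht : t ∈ Set.Icc s₀ s₁)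
    (hs : s ∈ Set.Icc s₀ s₁) (hts : t ≠ s) : 0 < wedge (g1 t) (g s - g t) := by
  rw [wedge_sub_right, sub_pos]
  rcases lt_or_gt_of_ne hts with hlt | hlt
  · have hm : StrictMonoOn (fun s => wedge (g1 t) (g s)) (Set.Icc t s₁) :=
      strictMonoOn_Icc_of_hasDerivAt_pos (fun τ => (h.hasDerivAt τ).const_wedge (g1 t))
        fun τ hτ => h.wedge_deriv_pos ht.1 hτ.1 hτ.2.le
    exact hm ⟨le_rfl, ht.2⟩ ⟨hlt.le, hs.2⟩ hlt
  · have hm : StrictMonoOn (fun s => wedge (g s) (g1 t)) (Set.Icc s₀ t) :=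
      strictMonoOn_Icc_of_hasDerivAt_pos (fun τ => (h.hasDerivAt τ).wedge_const (g1 t))
        fun τ hτ => h.wedge_deriv_pos hτ.1.le hτ.2 ht.2
    have := hm ⟨hs.1, hlt.le⟩ ⟨ht.1, le_rfl⟩ hlt
    rw [wedge_swap (g1 t), wedge_swap (g1 t)]
    exact neg_lt_neg this

theorem tangent_nonneg (h : IsArc g g1 g2 s₀ s₁) {t s : ℝ} (ht : t ∈ Set.Icc s₀ s₁)
    (hs : s ∈ Set.Icc s₀ s₁) : 0 ≤ wedge (g1 t) (g s - g t) := by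
  by_cases hts : t = s
  · subst hts; simp [wedge]
  · exact (h.tangent_pos ht hs hts).le

/-- Chords from the initial point turn left. -/
theorem wedge_chord_pos (h : IsArc g g1 g2 s₀ s₁) {t s : ℝ} (ht : s₀ < t) (hts : t < s)
    (hs : s ≤ s₁) : 0 < wedge (g t - g s₀) (g s - g s₀) := by
  have hm : StrictMonoOn (fun s => wedge (g t - g s₀) (g s)) (Set.Icc t s₁) := by
    refine strictMonoOn_Icc_of_hasDerivAt_pos
      (fun τ => (h.hasDerivAt τ).const_wedge (g t - g s₀)) fun τ hτ => ?_
    have hm' : StrictMonoOn (fun x => wedge (g x) (g1 τ)) (Set.Icc s₀ τ) :=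
      strictMonoOn_Icc_of_hasDerivAt_pos (fun x => (h.hasDerivAt x).wedge_const (g1 τ))
        fun x hx => h.wedge_deriv_pos hx.1.le hx.2 hτ.2.le
    rw [wedge_sub_left, sub_pos]
    exact hm' ⟨le_rfl, (ht.trans hτ.1).le⟩ ⟨ht.le, hτ.1.le⟩ ht
  have := hm ⟨le_rfl, hts.le.trans hs⟩ ⟨hts.le, hs⟩ hts
  simp only [wedge_sub_right, wedge_sub_left, wedge_self] at this ⊢
  rw [wedge_swap (g t) (g s₀)]
  linarith

theorem left_mem (h : IsArc g g1 g2 s₀ s₁) : s₀ ∈ Set.Icc s₀ s₁ := ⟨le_rfl, h.lt.le⟩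

theorem right_mem (h : IsArc g g1 g2 s₀ s₁) : s₁ ∈ Set.Icc s₀ s₁ := ⟨h.lt.le, le_rfl⟩

theorem mem_cap (h : IsArc g g1 g2 s₀ s₁) {t : ℝ} (ht : t ∈ Set.Icc s₀ s₁) :
    g t ∈ cap g g1 s₀ s₁ := by
  refine ⟨?_, fun s hs => h.tangent_nonneg hs ht⟩
  rcases eq_or_lt_of_le ht.1 with h0 | h0
  · rw [← h0]; simp [wedge]
  · rcases eq_or_lt_of_le ht.2 with h1 | h1
    · rw [h1, wedge_self]
    · exact (h.wedge_chord_pos h0 h1 le_rfl).le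

/-- A point of the cap on a tangent line is the point of tangency. -/
theorem eq_of_wedge_eq_zero (h : IsArc g g1 g2 s₀ s₁) {p : ℝ × ℝ} (hp : p ∈ cap g g1 s₀ s₁)
    {t : ℝ} (ht : t ∈ Set.Icc s₀ s₁) (h0 : wedge (g1 t) (p - g t) = 0) : p = g t := by
  have hne : g1 t ≠ 0 := left_ne_zero_of_wedge_ne_zero (h.pos t ht t ht).ne'
  obtain ⟨x, hx⟩ := exists_eq_smul_of_wedge_eq_zero hne h0
  have hpx : p = g t + x • g1 t := by rw [← hx]; abel
  -- the function `s ↦ g1 s ∧ (p - g s)` has derivative `-x (g1 t ∧ g2 t)` at `t`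
  have hd : HasDerivAt (fun s => wedge (g1 s) (p - g s)) (-x * wedge (g1 t) (g2 t)) t := by
    have h1 : HasDerivAt (fun s => p - g s) (-g1 t) t := by
      simpa using (h.hasDerivAt t).const_sub p
    convert (h.hasDerivAt' t).wedge h1 using 1
    rw [hx, wedge_smul_right, wedge_neg_right, wedge_self, wedge_swap (g2 t)]
    ring
  have hpos := h.pos t ht t ht
  have hnn : ∀ s ∈ Set.Icc s₀ s₁, wedge (g1 t) (p - g t) ≤ wedge (g1 s) (p - g s) := by
    intro s hs
    rw [h0]
    exact hp.2 s hs
  -- one-sided derivative tests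
  have hxle : t < s₁ → x ≤ 0 := by
    intro hlt
    by_contra! hx0
    have hneg : -x * wedge (g1 t) (g2 t) < 0 := by nlinarith
    have hev := (hasDerivAt_iff_tendsto_slope.1 hd).eventually (gt_mem_nhds hneg)
    have hev2 : ∀ᶠ s in nhdsWithin t (Set.Ioi t), s ∈ Set.Ioc t s₁ :=
      Ioc_mem_nhdsGT hlt
    obtain ⟨s, hs1, hs2⟩ := ((hev.filter_mono (nhdsWithin_mono t
      (show Set.Ioi t ⊆ {t}ᶜ from fun y hy => ne_of_gt hy))).and hev2).exists
    have := hnn s ⟨ht.1.trans hs2.1.le, hs2.2⟩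
    rw [slope_def_field, div_neg_iff] at hs1
    rcases hs1 with ⟨_, h3⟩ | ⟨h3, _⟩ <;> linarith [hs2.1]
  have hxge : s₀ < t → 0 ≤ x := by
    intro hlt
    by_contra! hx0
    have hneg : 0 < -x * wedge (g1 t) (g2 t) := by nlinarith
    have hev := (hasDerivAt_iff_tendsto_slope.1 hd).eventually (lt_mem_nhds hneg)
    have hev2 : ∀ᶠ s in nhdsWithin t (Set.Iio t), s ∈ Set.Ico s₀ t :=
      Ico_mem_nhdsLT hlt
    obtain ⟨s, hs1, hs2⟩ := ((hev.filter_mono (nhdsWithin_mono t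
      (show Set.Iio t ⊆ {t}ᶜ from fun y hy => ne_of_lt hy))).and hev2).exists
    have := hnn s ⟨hs2.1, hs2.2.le.trans ht.2⟩
    rw [slope_def_field, div_pos_iff] at hs1
    rcases hs1 with ⟨_, h3⟩ | ⟨h3, _⟩ <;> linarith [hs2.2]
  have hchord := hp.1
  have hx0 : x = 0 := by
    rcases eq_or_lt_of_le ht.1 with e0 | e0
    · subst e0
      have h1 := h.tangent_pos h.left_mem h.right_mem h.lt.ne
      rw [hx, wedge_smul_left] at hchord
      have : 0 ≤ x := by
        by_contra! hneg
        nlinarith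
      exact le_antisymm (hxle h.lt) this
    · rcases eq_or_lt_of_le ht.2 with e1 | e1
      · subst e1
        have h1 := h.tangent_pos h.right_mem h.left_mem h.lt.ne'
        have h2 : wedge (p - g s₀) (g t - g s₀) = -x * wedge (g1 t) (g s₀ - g t) := by
          rw [hpx]
          simp only [wedge_sub_left, wedge_sub_right, wedge_add_left, wedge_smul_left, wedge_self]
          rw [wedge_swap (g t) (g s₀)]
          ring
        rw [h2] at hchord
        have : x ≤ 0 := by
          by_contra! hneg
          nlinarith
        exact le_antisymm this (hxge e0)
      · exact le_antisymm (hxle e1) (hxge e0)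
  rw [hpx, hx0]; simp

theorem convex_cap : Convex ℝ (cap g g1 s₀ s₁) := by
  intro p hp q hq a b ha hb hab
  refine ⟨?_, fun t ht => ?_⟩
  · have h1 := hp.1
    have h2 := hq.1
    have : a • p + b • q - g s₀ = a • (p - g s₀) + b • (q - g s₀) := by
      obtain rfl : b = 1 - a := by linarith
      module
    rw [this, wedge_add_left, wedge_smul_left, wedge_smul_left]
    positivity
  · have h1 := hp.2 t ht
    have h2 := hq.2 t ht
    have : a • p + b • q - g t = a • (p - g t) + b • (q - g t) := by
      obtain rfl : b = 1 - a := by linarith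
      module
    rw [this, wedge_add_right, wedge_smul_right, wedge_smul_right]
    positivity

/-- The parametrization of the cap as a fan with apex at the initial point. -/
theorem exists_fan (h : IsArc g g1 g2 s₀ s₁) {p : ℝ × ℝ} (hp : p ∈ cap g g1 s₀ s₁)
    (hne : p ≠ g s₀) :
    ∃ x ∈ Set.Ioc (0 : ℝ) 1, ∃ t ∈ Set.Ioc s₀ s₁, p = g s₀ + x • (g t - g s₀) := by
  have h0 : 0 < wedge (g1 s₀) (p - g s₀) :=
    lt_of_le_of_ne (hp.2 s₀ h.left_mem)
      fun h0 => hne (h.eq_of_wedge_eq_zero hp h.left_mem h0.symm)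
  have hd : HasDerivAt (fun t => wedge (g t - g s₀) (p - g s₀)) (wedge (g1 s₀) (p - g s₀)) s₀ :=
    ((h.hasDerivAt s₀).sub_const (g s₀)).wedge_const (p - g s₀)
  have hcont : Continuous fun t => wedge (g t - g s₀) (p - g s₀) :=
    (h.continuous.sub continuous_const).wedge continuous_const
  have hev := (hasDerivAt_iff_tendsto_slope.1 hd).eventually (lt_mem_nhds h0)
  have hev2 : ∀ᶠ s in nhdsWithin s₀ (Set.Ioi s₀), s ∈ Set.Ioc s₀ s₁ := Ioc_mem_nhdsGT h.lt
  obtain ⟨s, hs1, hs2⟩ := ((hev.filter_mono (nhdsWithin_mono s₀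
      (show Set.Ioi s₀ ⊆ {s₀}ᶜ from fun y hy => ne_of_gt hy))).and hev2).exists
  rw [slope_def_field] at hs1
  have hspos : 0 ≤ wedge (g s - g s₀) (p - g s₀) := by
    rcases div_pos_iff.1 hs1 with ⟨h3, _⟩ | ⟨_, h3⟩
    · simpa [wedge_self, wedge] using h3.le
    · linarith [hs2.1]
  have hend : wedge (g s₁ - g s₀) (p - g s₀) ≤ 0 := by
    rw [wedge_swap]; linarith [hp.1]
  obtain ⟨t, ht, htz⟩ := intermediate_value_Icc' hs2.2 hcont.continuousOn ⟨hend, hspos⟩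
  have hts : s₀ < t := hs2.1.trans_le ht.1
  have htI : t ∈ Set.Icc s₀ s₁ := ⟨hts.le, ht.2⟩
  have h1 := h.tangent_pos h.left_mem htI hts.ne
  have h2 := h.tangent_pos htI h.left_mem hts.ne'
  have hgne : g t - g s₀ ≠ 0 := by
    intro h0
    rw [h0] at h1
    simp [wedge] at h1
  obtain ⟨x, hx⟩ := exists_eq_smul_of_wedge_eq_zero hgne htz
  refine ⟨x, ⟨?_, ?_⟩, t, ⟨hts, ht.2⟩, by rw [← hx]; abel⟩
  · rw [hx, wedge_smul_right] at h0
    by_contra! hc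
    nlinarith
  · have h3 := hp.2 t htI
    have : p - g t = (1 - x) • (g s₀ - g t) := by
      have : p = g s₀ + x • (g t - g s₀) := by rw [← hx]; abel
      rw [this]; module
    rw [this, wedge_smul_right] at h3
    by_contra! hc
    nlinarith

theorem fan_mem_cap (h : IsArc g g1 g2 s₀ s₁) {x t : ℝ} (hx : x ∈ Set.Icc (0 : ℝ) 1)
    (ht : t ∈ Set.Icc s₀ s₁) : g s₀ + x • (g t - g s₀) ∈ cap g g1 s₀ s₁ := by
  have hc : Convex ℝ (cap g g1 s₀ s₁) := convex_cap
  have := hc (h.mem_cap h.left_mem) (h.mem_cap ht) (a := 1 - x) (b := x)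
    (by linarith [hx.2]) hx.1 (by ring)
  convert this using 1
  module

theorem cap_eq_image (h : IsArc g g1 g2 s₀ s₁) :
    cap g g1 s₀ s₁ = (fun q : ℝ × ℝ => g s₀ + q.1 • (g q.2 - g s₀)) ''
      (Set.Icc 0 1 ×ˢ Set.Icc s₀ s₁) := by
  ext p
  constructor
  · intro hp
    by_cases hne : p = g s₀
    · exact ⟨(0, s₀), ⟨⟨le_rfl, zero_le_one⟩, h.left_mem⟩, by simp [hne]⟩
    · obtain ⟨x, hx, t, ht, rfl⟩ := h.exists_fan hp hne
      exact ⟨(x, t), ⟨⟨hx.1.le, hx.2⟩, ⟨ht.1.le, ht.2⟩⟩, rfl⟩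
  · rintro ⟨⟨x, t⟩, ⟨hx, ht⟩, rfl⟩
    exact h.fan_mem_cap hx ht

theorem isCompact_cap (h : IsArc g g1 g2 s₀ s₁) : IsCompact (cap g g1 s₀ s₁) := by
  rw [h.cap_eq_image]
  refine (isCompact_Icc.prod isCompact_Icc).image ?_
  have := h.continuous
  fun_prop

/-- A convex set containing the arc contains its cap. -/
theorem cap_subset (h : IsArc g g1 g2 s₀ s₁) {S : Set (ℝ × ℝ)} (hS : Convex ℝ S)
    (hg : ∀ t ∈ Set.Icc s₀ s₁, g t ∈ S) : cap g g1 s₀ s₁ ⊆ S := by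
  rw [h.cap_eq_image]
  rintro _ ⟨⟨x, t⟩, ⟨hx, ht⟩, rfl⟩
  have := hS (hg s₀ h.left_mem) (hg t ht) (a := 1 - x) (b := x)
    (by linarith [hx.2]) hx.1 (by ring)
  convert this using 1
  module

theorem injOn_fan (h : IsArc g g1 g2 s₀ s₁) :
    Set.InjOn (fun q : ℝ × ℝ => g s₀ + q.1 • (g q.2 - g s₀)) (Set.Ioc 0 1 ×ˢ Set.Ioc s₀ s₁) := by
  rintro ⟨x, t⟩ ⟨hx, ht⟩ ⟨y, s⟩ ⟨hy, hs⟩ heq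
  simp only [add_right_inj] at heq
  simp only at hx ht hy hs
  have key : ∀ {x t y s : ℝ}, 0 < x → 0 < y → t ∈ Set.Ioc s₀ s₁ → s ∈ Set.Ioc s₀ s₁ →
      x • (g t - g s₀) = y • (g s - g s₀) → ¬ t < s := by
    intro x t y s hx hy ht hs heq hlt
    have h1 := h.wedge_chord_pos ht.1 hlt hs.2
    have h2 : wedge (x • (g t - g s₀)) (y • (g s - g s₀)) = 0 := by rw [heq, wedge_self]
    rw [wedge_smul_left, wedge_smul_right] at h2
    have : 0 < x * (y * wedge (g t - g s₀) (g s - g s₀)) := by positivity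
    linarith
  have hts : t = s := by
    rcases lt_trichotomy t s with h1 | h1 | h1
    · exact absurd h1 (key hx.1 hy.1 ht hs heq)
    · exact h1
    · exact absurd h1 (key hy.1 hx.1 hs ht heq.symm)
  subst hts
  have hne : g t - g s₀ ≠ 0 := by
    intro h0
    have := h.tangent_pos h.left_mem ⟨ht.1.le, ht.2⟩ ht.1.ne
    rw [h0] at this
    simp [wedge] at this
  have := smul_left_injective ℝ hne heq
  rw [this]

/-- The area of a cap. -/
theorem volume_cap (h : IsArc g g1 g2 s₀ s₁) :
    volume (cap g g1 s₀ s₁) =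
      ENNReal.ofReal (1 / 2 * ∫ t in s₀..s₁, wedge (g t - g s₀) (g1 t)) := by
  set Φ : ℝ × ℝ → ℝ × ℝ := fun q => g s₀ + q.1 • (g q.2 - g s₀) with hΦ
  set D : Set (ℝ × ℝ) := Set.Ioc 0 1 ×ˢ Set.Ioc s₀ s₁ with hD
  have hDm : MeasurableSet D := measurableSet_Ioc.prod measurableSet_Ioc
  let A : ℝ × ℝ → (ℝ × ℝ →L[ℝ] ℝ × ℝ) := fun q => LinearMap.toContinuousLinearMap
    ((Matrix.toLin (Module.Basis.finTwoProd ℝ) (Module.Basis.finTwoProd ℝ))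
      !![(g q.2 - g s₀).1, q.1 * (g1 q.2).1; (g q.2 - g s₀).2, q.1 * (g1 q.2).2])
  have hdet : ∀ q, (A q).det = q.1 * wedge (g q.2 - g s₀) (g1 q.2) := by
    intro q
    simp only [A, LinearMap.det_toContinuousLinearMap, LinearMap.det_toLin, Matrix.det_fin_two_of,
      wedge]
    ring
  have hderiv : ∀ q, HasFDerivAt Φ (A q) q := by
    intro q
    have hg : HasFDerivAt (fun q : ℝ × ℝ => g q.2)
        ((ContinuousLinearMap.snd ℝ ℝ ℝ).smulRight (g1 q.2)) q := by
      have h1 := (h.hasDerivAt q.2).hasFDerivAt.comp q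
        (hasFDerivAt_snd (𝕜 := ℝ) (E := ℝ) (F := ℝ) (p := q))
      refine HasFDerivAt.congr_fderiv h1 ?_
      apply ContinuousLinearMap.ext
      intro v
      simp
    have h2 := ((hasFDerivAt_fst (𝕜 := ℝ) (E := ℝ) (F := ℝ) (p := q)).smul
      (hg.sub_const (g s₀))).const_add (g s₀)
    refine h2.congr_fderiv ?_
    apply ContinuousLinearMap.ext
    intro v
    simp only [A, LinearMap.coe_toContinuousLinearMap', Matrix.toLin_finTwoProd_apply]
    ext <;> simp <;> ring
  have himg : cap g g1 s₀ s₁ = insert (g s₀) (Φ '' D) := by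
    ext p
    constructor
    · intro hp
      by_cases hne : p = g s₀
      · exact Or.inl hne
      · obtain ⟨x, hx, t, ht, rfl⟩ := h.exists_fan hp hne
        exact Or.inr ⟨(x, t), ⟨hx, ht⟩, rfl⟩
    · rintro (rfl | ⟨⟨x, t⟩, ⟨hx, ht⟩, rfl⟩)
      · exact h.mem_cap h.left_mem
      · exact h.fan_mem_cap ⟨hx.1.le, hx.2⟩ ⟨ht.1.le, ht.2⟩
  have hvol : volume (cap g g1 s₀ s₁) = volume (Φ '' D) := by
    rw [himg]
    exact measure_congr (insert_ae_eq_self _ _)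
  have hnn : ∀ t ∈ Set.Ioc s₀ s₁, 0 ≤ wedge (g t - g s₀) (g1 t) := by
    intro t ht
    have h3 := h.tangent_pos ⟨ht.1.le, ht.2⟩ h.left_mem ht.1.ne'
    rw [wedge_swap, ← wedge_neg_right, neg_sub]
    exact h3.le
  have hcw : Continuous fun t => wedge (g t - g s₀) (g1 t) :=
    (h.continuous.sub continuous_const).wedge h.continuous'
  rw [hvol, ← lintegral_abs_det_fderiv_eq_addHaar_image volume hDm
    (fun q _ => (hderiv q).hasFDerivWithinAt) h.injOn_fan]
  have hcongr : ∫⁻ q in D, ENNReal.ofReal |(A q).det| =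
      ∫⁻ q in D, ENNReal.ofReal (q.1 * wedge (g q.2 - g s₀) (g1 q.2)) := by
    refine setLIntegral_congr_fun hDm fun q hq => ?_
    rw [hdet, abs_of_nonneg (mul_nonneg hq.1.1.le (hnn _ hq.2))]
  have hint : IntegrableOn (fun q : ℝ × ℝ => q.1 * wedge (g q.2 - g s₀) (g1 q.2)) D := by
    have hc : Continuous fun q : ℝ × ℝ => q.1 * wedge (g q.2 - g s₀) (g1 q.2) :=
      continuous_fst.mul (hcw.comp continuous_snd)
    exact (hc.continuousOn.integrableOn_compact (isCompact_Icc.prod isCompact_Icc)).mono_set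
      (Set.prod_mono Set.Ioc_subset_Icc_self Set.Ioc_subset_Icc_self)
  rw [hcongr, ← ofReal_integral_eq_lintegral_ofReal hint]
  · congr 1
    rw [hD, Measure.volume_eq_prod, setIntegral_prod_mul (fun x : ℝ => x)
      (fun t => wedge (g t - g s₀) (g1 t)), ← intervalIntegral.integral_of_le zero_le_one,
      ← intervalIntegral.integral_of_le h.lt.le, integral_id]
    norm_num
  · exact (ae_restrict_iff' hDm).2
      (Filter.Eventually.of_forall fun q hq => mul_nonneg hq.1.1.le (hnn _ hq.2))

end IsArc

/-- Arcs `g j` on the boundary of a convex body `K`, and replacement arcs `h j` that agree with them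
to first order at the endpoints. -/
structure Surgery {ι : Type*} (K : Set (ℝ × ℝ)) (g g1 g2 h h1 h2 : ι → ℝ → ℝ × ℝ) (s₀ s₁ : ℝ) :
    Prop where
  convex : Convex ℝ K
  isCompact : IsCompact K
  zero_mem : (0 : ℝ × ℝ) ∈ interior K
  arc : ∀ j, IsArc (g j) (g1 j) (g2 j) s₀ s₁
  arc' : ∀ j, IsArc (h j) (h1 j) (h2 j) s₀ s₁
  left_eq : ∀ j, h j s₀ = g j s₀
  right_eq : ∀ j, h j s₁ = g j s₁
  left_eq' : ∀ j, h1 j s₀ = g1 j s₀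
  right_eq' : ∀ j, h1 j s₁ = g1 j s₁
  mem : ∀ j, ∀ t ∈ Set.Icc s₀ s₁, g j t ∈ K
  support : ∀ j, ∀ t ∈ Set.Icc s₀ s₁, ∀ p ∈ K, 0 ≤ wedge (g1 j t) (p - g j t)
  sep : ∀ i j, i ≠ j → ∀ τ ∈ Set.Icc s₀ s₁, ∀ t ∈ Set.Icc s₀ s₁, ∀ s ∈ Set.Icc s₀ s₁,
    0 < wedge (g1 i τ) (g j t - g i s)
  sep' : ∀ i j, i ≠ j → ∀ τ ∈ Set.Icc s₀ s₁, ∀ t ∈ Set.Icc s₀ s₁, ∀ s ∈ Set.Icc s₀ s₁,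
    0 < wedge (g1 i τ) (h j t - g i s)
  sep_zero : ∀ i, ∀ τ ∈ Set.Icc s₀ s₁, ∀ s ∈ Set.Icc s₀ s₁, 0 < wedge (g1 i τ) (-g i s)

/-- The signed position of `p` with respect to the line through `P` and `Q`. -/
def chordSide (P Q p : ℝ × ℝ) : ℝ := wedge (p - P) (Q - P)

theorem chordSide_combo (P Q p q : ℝ × ℝ) {a b : ℝ} (hab : a + b = 1) :
    chordSide P Q (a • p + b • q) = a * chordSide P Q p + b * chordSide P Q q := by
  obtain rfl : b = 1 - a := by linarith
  simp [chordSide, wedge]; ring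

theorem continuous_chordSide (P Q : ℝ × ℝ) : Continuous (chordSide P Q) :=
  (continuous_id.sub continuous_const).wedge continuous_const

theorem convex_chordSide_neg (P Q : ℝ × ℝ) : Convex ℝ {p | chordSide P Q p < 0} := by
  intro p hp q hq a b ha hb hab
  rw [Set.mem_ofPred_eq] at *
  rw [chordSide_combo _ _ _ _ hab]
  rcases eq_or_lt_of_le ha with h | h
  · have : b = 1 := by linarith
    rw [← h, this]; linarith
  · nlinarith

theorem convex_wedge_nonneg (v q : ℝ × ℝ) : Convex ℝ {p | 0 ≤ wedge v (p - q)} := by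
  intro x hx y hy a b ha hb hab
  rw [Set.mem_ofPred_eq] at *
  obtain rfl : b = 1 - a := by linarith
  have : a • x + (1 - a) • y - q = a • (x - q) + (1 - a) • (y - q) := by module
  rw [this, wedge_add_right, wedge_smul_right, wedge_smul_right]
  positivity

theorem IsArc.chordSide_neg {g g1 g2 : ℝ → ℝ × ℝ} {s₀ s₁ : ℝ} (h : IsArc g g1 g2 s₀ s₁)
    {x : ℝ × ℝ} (hx : ∀ τ ∈ Set.Icc s₀ s₁, 0 < wedge (g1 τ) (x - g s₀)) :
    chordSide (g s₀) (g s₁) x < 0 := by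
  have hm : StrictMonoOn (fun τ => wedge (g τ) (x - g s₀)) (Set.Icc s₀ s₁) :=
    strictMonoOn_Icc_of_hasDerivAt_pos (fun τ => (h.hasDerivAt τ).wedge_const (x - g s₀))
      fun τ hτ => hx τ ⟨hτ.1.le, hτ.2.le⟩
  have := hm h.left_mem h.right_mem h.lt
  simp only at this
  rw [chordSide, wedge_swap, wedge_sub_left]
  linarith

/-- The part of `K` on the inner side of all chords, together with the caps `C j`. -/
def capped {ι : Type*} (K : Set (ℝ × ℝ)) (L : ι → ℝ × ℝ → ℝ) (C : ι → Set (ℝ × ℝ)) :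
    Set (ℝ × ℝ) :=
  {p | p ∈ K ∧ ∀ j, L j p < 0} ∪ ⋃ j, C j

theorem volume_capped {ι : Type*} [Fintype ι] {K : Set (ℝ × ℝ)}
    {L : ι → ℝ × ℝ → ℝ} {C : ι → Set (ℝ × ℝ)}
    (hC : ∀ j, MeasurableSet (C j)) (h1 : ∀ j, ∀ p ∈ C j, 0 ≤ L j p)
    (h2 : ∀ i j, i ≠ j → ∀ p ∈ C j, L i p < 0) :
    volume (capped K L C) = volume {p | p ∈ K ∧ ∀ j, L j p < 0} + ∑ j, volume (C j) := by
  rw [capped, measure_union _ (MeasurableSet.iUnion hC), measure_iUnion _ hC, tsum_fintype]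
  · intro i j hij
    refine Set.disjoint_left.2 fun p hi hj => ?_
    have := h1 i p hi
    have := h2 i j hij p hj
    linarith
  · refine Set.disjoint_left.2 fun p hp hj => ?_
    obtain ⟨j, hj⟩ := Set.mem_iUnion.1 hj
    have := h1 j p hj
    have := hp.2 j
    linarith

theorem Convex.mem_of_mem_opposite {K : Set (ℝ × ℝ)} (hK : Convex ℝ K) {z d : ℝ × ℝ} {a b : ℝ}
    (ha : 0 < a) (hb : 0 < b) (hx : z + a • d ∈ K) (hy : z - b • d ∈ K) : z ∈ K := by
  have hab : a + b ≠ 0 := by positivity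
  have := hK hx hy (a := b / (a + b)) (b := a / (a + b)) (by positivity) (by positivity)
    (by field_simp; ring)
  convert this using 1
  have e1 : b / (a + b) + a / (a + b) = 1 := by field_simp; ring
  have e2 : b / (a + b) * a = a / (a + b) * b := by ring
  calc z = (b / (a + b) + a / (a + b)) • z + (b / (a + b) * a - a / (a + b) * b) • d := by
        rw [e1, e2]; simp
    _ = _ := by module

namespace Surgery

variable {ι : Type*} {K : Set (ℝ × ℝ)} {g g1 g2 h h1 h2 : ι → ℝ → ℝ × ℝ} {s₀ s₁ : ℝ}

/-- The body obtained from `K` by replacing the arcs. -/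
def body (K : Set (ℝ × ℝ)) (g h h1 : ι → ℝ → ℝ × ℝ) (s₀ s₁ : ℝ) : Set (ℝ × ℝ) :=
  capped K (fun j => chordSide (g j s₀) (g j s₁)) (fun j => cap (h j) (h1 j) s₀ s₁)

theorem chordSide_zero_neg (S : Surgery K g g1 g2 h h1 h2 s₀ s₁) (j : ι) :
    chordSide (g j s₀) (g j s₁) 0 < 0 :=
  (S.arc j).chordSide_neg fun τ hτ => by
    simpa using S.sep_zero j τ hτ s₀ (S.arc j).left_mem

theorem chordSide_nonneg' (S : Surgery K g g1 g2 h h1 h2 s₀ s₁) {j : ι} {p : ℝ × ℝ}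
    (hp : p ∈ cap (h j) (h1 j) s₀ s₁) : 0 ≤ chordSide (g j s₀) (g j s₁) p := by
  have := hp.1
  rwa [S.left_eq, S.right_eq] at this

theorem chordSide_neg (S : Surgery K g g1 g2 h h1 h2 s₀ s₁) {i j : ι} (hij : i ≠ j) {p : ℝ × ℝ}
    (hp : p ∈ cap (g j) (g1 j) s₀ s₁) : chordSide (g i s₀) (g i s₁) p < 0 :=
  (S.arc j).cap_subset (convex_chordSide_neg _ _) (fun t ht =>
    (S.arc i).chordSide_neg fun τ hτ => S.sep i j hij τ hτ t ht s₀ (S.arc i).left_mem) hp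

theorem chordSide_neg' (S : Surgery K g g1 g2 h h1 h2 s₀ s₁) {i j : ι} (hij : i ≠ j) {p : ℝ × ℝ}
    (hp : p ∈ cap (h j) (h1 j) s₀ s₁) : chordSide (g i s₀) (g i s₁) p < 0 :=
  (S.arc' j).cap_subset (convex_chordSide_neg _ _) (fun t ht =>
    (S.arc i).chordSide_neg fun τ hτ => S.sep' i j hij τ hτ t ht s₀ (S.arc i).left_mem) hp

theorem mem_cap_iff (S : Surgery K g g1 g2 h h1 h2 s₀ s₁) {j : ι} {p : ℝ × ℝ} :
    p ∈ cap (g j) (g1 j) s₀ s₁ ↔ p ∈ K ∧ 0 ≤ chordSide (g j s₀) (g j s₁) p :=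
  ⟨fun hp => ⟨(S.arc j).cap_subset S.convex (S.mem j) hp, hp.1⟩,
    fun hp => ⟨hp.2, fun t ht => S.support j t ht p hp.1⟩⟩

theorem eq_capped (S : Surgery K g g1 g2 h h1 h2 s₀ s₁) :
    K = capped K (fun j => chordSide (g j s₀) (g j s₁)) (fun j => cap (g j) (g1 j) s₀ s₁) := by
  ext p
  constructor
  · intro hp
    by_cases hn : ∀ j, chordSide (g j s₀) (g j s₁) p < 0
    · exact Or.inl ⟨hp, hn⟩
    · push Not at hn
      obtain ⟨j, hj⟩ := hn
      exact Or.inr (Set.mem_iUnion.2 ⟨j, S.mem_cap_iff.2 ⟨hp, hj⟩⟩)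
  · rintro (hp | hp)
    · exact hp.1
    · obtain ⟨j, hj⟩ := Set.mem_iUnion.1 hp
      exact (S.mem_cap_iff.1 hj).1

/-- The intersection of the half-planes bounded by the tangents at the endpoints of an arc. -/
def wedgeRegion (g g1 : ι → ℝ → ℝ × ℝ) (s₀ s₁ : ℝ) (j : ι) : Set (ℝ × ℝ) :=
  {p | 0 ≤ wedge (g1 j s₀) (p - g j s₀)} ∩ {p | 0 ≤ wedge (g1 j s₁) (p - g j s₁)}

theorem convex_wedgeRegion (j : ι) : Convex ℝ (wedgeRegion g g1 s₀ s₁ j) :=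
  (convex_wedge_nonneg _ _).inter (convex_wedge_nonneg _ _)

theorem body_subset_wedgeRegion (S : Surgery K g g1 g2 h h1 h2 s₀ s₁) (j : ι) :
    body K g h h1 s₀ s₁ ⊆ wedgeRegion g g1 s₀ s₁ j := by
  have hl := (S.arc j).left_mem
  have hr := (S.arc j).right_mem
  rintro p (hp | hp)
  · exact ⟨S.support j _ hl p hp.1, S.support j _ hr p hp.1⟩
  · obtain ⟨i, hi⟩ := Set.mem_iUnion.1 hp
    by_cases hij : j = i
    · subst hij
      have e1 := hi.2 _ hl
      have e2 := hi.2 _ hr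
      rw [S.left_eq, S.left_eq'] at e1
      rw [S.right_eq, S.right_eq'] at e2
      exact ⟨e1, e2⟩
    · exact (S.arc' i).cap_subset (convex_wedgeRegion j) (fun t ht =>
        ⟨(S.sep' j i hij _ hl t ht _ hl).le, (S.sep' j i hij _ hr t ht _ hr).le⟩) hi

theorem mem_caps_of_chordSide_eq_zero (S : Surgery K g g1 g2 h h1 h2 s₀ s₁) {j : ι} {z : ℝ × ℝ}
    (hz : z ∈ wedgeRegion g g1 s₀ s₁ j) (h0 : chordSide (g j s₀) (g j s₁) z = 0) :
    z ∈ cap (g j) (g1 j) s₀ s₁ ∧ z ∈ cap (h j) (h1 j) s₀ s₁ := by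
  have hl := (S.arc j).left_mem
  have hr := (S.arc j).right_mem
  have e1 := (S.arc j).tangent_pos hl hr (S.arc j).lt.ne
  have e2 := (S.arc j).tangent_pos hr hl (S.arc j).lt.ne'
  have hne : g j s₁ - g j s₀ ≠ 0 := by
    intro hc
    rw [hc] at e1
    simp [wedge] at e1
  rw [chordSide, wedge_swap, neg_eq_zero] at h0
  obtain ⟨x, hx⟩ := exists_eq_smul_of_wedge_eq_zero hne h0
  have hzx : z = g j s₀ + x • (g j s₁ - g j s₀) := by rw [← hx]; abel
  have f1 : 0 ≤ wedge (g1 j s₀) (z - g j s₀) := hz.1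
  have f2 : 0 ≤ wedge (g1 j s₁) (z - g j s₁) := hz.2
  rw [hx, wedge_smul_right] at f1
  rw [show z - g j s₁ = (1 - x) • (g j s₀ - g j s₁) by rw [hzx]; module, wedge_smul_right] at f2
  have hxI : x ∈ Set.Icc (0 : ℝ) 1 := by
    constructor
    · by_contra! hc
      nlinarith
    · by_contra! hc
      nlinarith
  refine ⟨?_, ?_⟩
  · rw [hzx]
    exact (S.arc j).fan_mem_cap hxI hr
  · rw [hzx, ← S.left_eq, ← S.right_eq]
    exact (S.arc' j).fan_mem_cap hxI hr

theorem cap_subset_body (j : ι) : cap (h j) (h1 j) s₀ s₁ ⊆ body K g h h1 s₀ s₁ :=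
  fun _ hp => Or.inr (Set.mem_iUnion.2 ⟨j, hp⟩)

theorem mem_cap_of_mem_body (S : Surgery K g g1 g2 h h1 h2 s₀ s₁) {j : ι} {p : ℝ × ℝ}
    (hp : p ∈ body K g h h1 s₀ s₁) (hj : 0 ≤ chordSide (g j s₀) (g j s₁) p) :
    p ∈ cap (h j) (h1 j) s₀ s₁ := by
  rcases hp with hp | hp
  · exact absurd (hp.2 j) (not_lt.2 hj)
  · obtain ⟨i, hi⟩ := Set.mem_iUnion.1 hp
    by_cases hij : j = i
    · rwa [hij]
    · exact absurd (S.chordSide_neg' hij hi) (not_lt.2 hj)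

/-- If a segment crosses a chord line, then the crossing point lies in both caps. -/
theorem exists_crossing (S : Surgery K g g1 g2 h h1 h2 s₀ s₁) {j : ι} {x z : ℝ × ℝ}
    (hx : x ∈ wedgeRegion g g1 s₀ s₁ j) (hz : z ∈ wedgeRegion g g1 s₀ s₁ j)
    (hx0 : 0 ≤ chordSide (g j s₀) (g j s₁) x) (hz0 : chordSide (g j s₀) (g j s₁) z < 0) :
    ∃ r : ℝ, 0 < r ∧ r ≤ 1 ∧ z + r • (x - z) ∈ cap (g j) (g1 j) s₀ s₁ ∧
      z + r • (x - z) ∈ cap (h j) (h1 j) s₀ s₁ := by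
  set L := chordSide (g j s₀) (g j s₁) with hL
  have hd : 0 < L x - L z := by linarith
  refine ⟨-L z / (L x - L z), div_pos (by linarith) hd, (div_le_one hd).2 (by linarith), ?_⟩
  set r := -L z / (L x - L z) with hr
  have hr0 : 0 < r := div_pos (by linarith) hd
  have hr1 : r ≤ 1 := (div_le_one hd).2 (by linarith)
  have he : z + r • (x - z) = (1 - r) • z + r • x := by module
  rw [he]
  refine S.mem_caps_of_chordSide_eq_zero
    (convex_wedgeRegion j hz hx (by linarith) hr0.le (by ring)) ?_
  rw [← hL, hL, chordSide_combo _ _ _ _ (by ring), ← hL]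
  have : r * (L x - L z) = -L z := by rw [hr]; field_simp
  linarith

theorem convex_body (S : Surgery K g g1 g2 h h1 h2 s₀ s₁) : Convex ℝ (body K g h h1 s₀ s₁) := by
  intro x hx y hy a b ha hb hab
  rcases eq_or_lt_of_le ha with ha0 | ha0
  · have : b = 1 := by linarith
    rw [← ha0, this]; simpa using hy
  rcases eq_or_lt_of_le hb with hb0 | hb0
  · have : a = 1 := by linarith
    rw [← hb0, this]; simpa using hx
  set z := a • x + b • y with hz
  have hzN : ∀ j, z ∈ wedgeRegion g g1 s₀ s₁ j := fun j =>
    convex_wedgeRegion j (S.body_subset_wedgeRegion j hx) (S.body_subset_wedgeRegion j hy) ha hb hab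
  by_cases hn : ∀ j, chordSide (g j s₀) (g j s₁) z < 0
  · -- move both endpoints into `K`
    have key : ∀ x ∈ body K g h h1 s₀ s₁, ∃ r : ℝ, 0 < r ∧ z + r • (x - z) ∈ K := by
      intro x hx
      by_cases hxn : ∀ j, chordSide (g j s₀) (g j s₁) x < 0
      · refine ⟨1, one_pos, ?_⟩
        rcases hx with hx | hx
        · simpa using hx.1
        · obtain ⟨j, hj⟩ := Set.mem_iUnion.1 hx
          exact absurd (hxn j) (not_lt.2 (S.chordSide_nonneg' hj))
      · push Not at hxn
        obtain ⟨j, hj⟩ := hxn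
        obtain ⟨r, hr0, -, hr, -⟩ :=
          S.exists_crossing (S.body_subset_wedgeRegion j hx) (hzN j) hj (hn j)
        exact ⟨r, hr0, (S.mem_cap_iff.1 hr).1⟩
    obtain ⟨r, hr0, hr⟩ := key x hx
    obtain ⟨s, hs0, hs⟩ := key y hy
    have ex : x - z = b • (x - y) := by
      rw [hz]; obtain rfl : b = 1 - a := by linarith
      module
    have ey : y - z = -(a • (x - y)) := by
      rw [hz]; obtain rfl : b = 1 - a := by linarith
      module
    rw [ex, smul_smul] at hr
    rw [ey, smul_neg, smul_smul, ← sub_eq_add_neg] at hs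
    exact Or.inl ⟨S.convex.mem_of_mem_opposite (mul_pos hr0 hb0) (mul_pos hs0 ha0) hr hs, hn⟩
  · push Not at hn
    obtain ⟨j, hj⟩ := hn
    refine cap_subset_body j ?_
    have hc : Convex ℝ (cap (h j) (h1 j) s₀ s₁) := IsArc.convex_cap
    -- an endpoint on the inner side can be moved to the chord
    have key : ∀ {x y : ℝ × ℝ} {a b : ℝ}, 0 < a → 0 < b → a + b = 1 →
        x ∈ body K g h h1 s₀ s₁ → y ∈ body K g h h1 s₀ s₁ →
        0 ≤ chordSide (g j s₀) (g j s₁) (a • x + b • y) →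
        0 ≤ chordSide (g j s₀) (g j s₁) y → a • x + b • y ∈ cap (h j) (h1 j) s₀ s₁ := by
      intro x y a b ha hb hab hx hy hz0 hy0
      have hyC := S.mem_cap_of_mem_body hy hy0
      by_cases hx0 : 0 ≤ chordSide (g j s₀) (g j s₁) x
      · exact hc (S.mem_cap_of_mem_body hx hx0) hyC ha.le hb.le hab
      · push Not at hx0
        have hxN := S.body_subset_wedgeRegion j hx
        have hyN := S.body_subset_wedgeRegion j hy
        obtain ⟨r, hr0, hr1, -, hr⟩ := S.exists_crossing
          (convex_wedgeRegion j hxN hyN ha.le hb.le hab) hxN hz0 hx0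
        have e1 : x + r • (a • x + b • y - x) = x + (r * b) • (y - x) := by
          obtain rfl : b = 1 - a := by linarith
          module
        rw [e1] at hr
        have hb1 : b < 1 := by linarith
        have hrb : r * b ≤ b := by nlinarith
        have hrb1 : 0 < 1 - r * b := by linarith
        have := hc hr hyC (a := a / (1 - r * b)) (b := (b - r * b) / (1 - r * b))
          (by positivity) (div_nonneg (by linarith) hrb1.le) (by field_simp; linarith)
        convert this using 1
        have ha' : a = (1 - r * b) * (a / (1 - r * b)) := by field_simp
        obtain rfl : b = 1 - a := by linarith
        set q := a / (1 - r * (1 - a)) with hq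
        have e2 : (1 - a - r * (1 - a)) / (1 - r * (1 - a)) = 1 - q := by
          rw [hq, eq_sub_iff_add_eq, ← add_div, div_eq_one_iff_eq hrb1.ne']
          ring
        rw [e2]
        have e3 : a • x + (1 - a) • y = y + a • (x - y) := by module
        rw [e3]
        nth_rewrite 1 [ha']
        module
    by_cases hy0 : 0 ≤ chordSide (g j s₀) (g j s₁) y
    · exact key ha0 hb0 hab hx hy hj hy0
    · have hx0 : 0 ≤ chordSide (g j s₀) (g j s₁) x := by
        rw [hz, chordSide_combo _ _ _ _ hab] at hj
        push Not at hy0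
        by_contra! hc
        nlinarith
      rw [hz, add_comm]
      exact key hb0 ha0 (by linarith) hy hx (by rwa [add_comm]) hx0

theorem isCompact_body [Finite ι] (S : Surgery K g g1 g2 h h1 h2 s₀ s₁) :
    IsCompact (body K g h h1 s₀ s₁) := by
  have he : body K g h h1 s₀ s₁ =
      (K ∩ ⋂ j, {p | chordSide (g j s₀) (g j s₁) p ≤ 0}) ∪ ⋃ j, cap (h j) (h1 j) s₀ s₁ := by
    ext p
    constructor
    · rintro (hp | hp)
      · exact Or.inl ⟨hp.1, Set.mem_iInter.2 fun j => (hp.2 j).le⟩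
      · exact Or.inr hp
    · rintro (hp | hp)
      · by_cases hn : ∀ j, chordSide (g j s₀) (g j s₁) p < 0
        · exact Or.inl ⟨hp.1, hn⟩
        · push Not at hn
          obtain ⟨j, hj⟩ := hn
          have hj' : chordSide (g j s₀) (g j s₁) p ≤ 0 := Set.mem_iInter.1 hp.2 j
          refine cap_subset_body j (S.mem_caps_of_chordSide_eq_zero ⟨?_, ?_⟩
            (le_antisymm hj' hj)).2
          · exact S.support j _ (S.arc j).left_mem p hp.1
          · exact S.support j _ (S.arc j).right_mem p hp.1
      · exact Or.inr hp
  rw [he]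
  refine (S.isCompact.inter_right (isClosed_iInter fun j => ?_)).union
    (isCompact_iUnion fun j => (S.arc' j).isCompact_cap)
  exact isClosed_le (continuous_chordSide _ _) continuous_const

theorem isOpen_inner [Finite ι] : IsOpen {p | ∀ j : ι, chordSide (g j s₀) (g j s₁) p < 0} := by
  rw [Set.ofPred_forall]
  exact isOpen_iInter_of_finite fun j => isOpen_lt (continuous_chordSide _ _) continuous_const

theorem mem_interior_body [Finite ι] {p : ℝ × ℝ} (hp : p ∈ interior K)
    (hn : ∀ j, chordSide (g j s₀) (g j s₁) p < 0) : p ∈ interior (body K g h h1 s₀ s₁) :=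
  interior_maximal (t := interior K ∩ {p | ∀ j : ι, chordSide (g j s₀) (g j s₁) p < 0})
    (fun _ hq => Or.inl ⟨interior_subset hq.1, hq.2⟩) (isOpen_interior.inter isOpen_inner) ⟨hp, hn⟩

theorem zero_mem_interior_body [Finite ι] (S : Surgery K g g1 g2 h h1 h2 s₀ s₁) :
    (0 : ℝ × ℝ) ∈ interior (body K g h h1 s₀ s₁) :=
  mem_interior_body S.zero_mem S.chordSide_zero_neg

theorem volume_body [Fintype ι] (S : Surgery K g g1 g2 h h1 h2 s₀ s₁) :
    volume (body K g h h1 s₀ s₁) + ∑ j, volume (cap (g j) (g1 j) s₀ s₁) =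
      volume K + ∑ j, volume (cap (h j) (h1 j) s₀ s₁) := by
  have e1 := volume_capped (K := K) (L := fun j => chordSide (g j s₀) (g j s₁))
    (fun j => (S.arc' j).isCompact_cap.isClosed.measurableSet)
    (fun j p hp => S.chordSide_nonneg' hp) (fun i j hij p hp => S.chordSide_neg' hij hp)
  have e2 := volume_capped (K := K) (L := fun j => chordSide (g j s₀) (g j s₁))
    (fun j => (S.arc j).isCompact_cap.isClosed.measurableSet)
    (fun j p hp => hp.1) (fun i j hij p hp => S.chordSide_neg hij hp)
  rw [← S.eq_capped] at e2
  rw [body, e1, e2, add_right_comm]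

theorem frontier_body_subset [Finite ι] (S : Surgery K g g1 g2 h h1 h2 s₀ s₁) {p : ℝ × ℝ}
    (hp : p ∈ frontier (body K g h h1 s₀ s₁)) :
    p ∈ frontier K ∨ ∃ j, ∃ t ∈ Set.Icc s₀ s₁, p = h j t := by
  have hpi := notMem_interior_of_mem_frontier hp
  have hpB := S.isCompact_body.isClosed.frontier_subset hp
  by_cases hn : ∀ j, chordSide (g j s₀) (g j s₁) p < 0
  · left
    have hpK : p ∈ K := by
      rcases hpB with hp | hp
      · exact hp.1
      · obtain ⟨j, hj⟩ := Set.mem_iUnion.1 hp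
        exact absurd (hn j) (not_lt.2 (S.chordSide_nonneg' hj))
    exact ⟨subset_closure hpK, fun hi => hpi (mem_interior_body hi hn)⟩
  · right
    push Not at hn
    obtain ⟨j, hj⟩ := hn
    have hpC := S.mem_cap_of_mem_body hpB hj
    refine ⟨j, ?_⟩
    by_contra! hne
    have hpos : ∀ t ∈ Set.Icc s₀ s₁, 0 < wedge (h1 j t) (p - h j t) := fun t ht =>
      lt_of_le_of_ne (hpC.2 t ht)
        fun h0 => hne t ht ((S.arc' j).eq_of_wedge_eq_zero hpC ht h0.symm)
    have hev : ∀ᶠ r in nhds (0 : ℝ), ∀ t ∈ Set.Icc s₀ s₁,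
        0 < wedge (h1 j t) ((1 + r) • p - h j t) := by
      refine isCompact_Icc.eventually_forall_of_forall_eventually fun t ht => ?_
      have hc : Continuous fun q : ℝ × ℝ => wedge (h1 j q.2) ((1 + q.1) • p - h j q.2) := by
        refine Continuous.wedge ((S.arc' j).continuous'.comp continuous_snd) ?_
        have := (S.arc' j).continuous
        fun_prop
      refine hc.continuousAt.eventually (lt_mem_nhds ?_)
      simpa using hpos t ht
    have hev2 : ∀ᶠ r in nhdsWithin (0 : ℝ) (Set.Ioi 0), 0 < r := self_mem_nhdsWithin
    obtain ⟨r, hr, hr0⟩ := ((hev.filter_mono nhdsWithin_le_nhds).and hev2).exists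
    have hz := S.chordSide_zero_neg j
    have hmem : (1 + r) • p ∈ cap (h j) (h1 j) s₀ s₁ := by
      refine ⟨?_, fun t ht => (hr t ht).le⟩
      rw [S.left_eq, S.right_eq]
      have := chordSide_combo (g j s₀) (g j s₁) p 0 (a := 1 + r) (b := -r) (by ring)
      rw [smul_zero, add_zero] at this
      change 0 ≤ chordSide (g j s₀) (g j s₁) ((1 + r) • p)
      rw [this]
      nlinarith
    refine hpi ?_
    have := smul_mem_interior S.convex_body S.zero_mem_interior_body (cap_subset_body j hmem)
      (t := (1 + r)⁻¹) (by positivity) (inv_lt_one_of_one_lt₀ (by linarith))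
    rwa [smul_smul, inv_mul_cancel₀ (by positivity), one_smul] at this

theorem isCSCD_body [Finite ι] (S : Surgery K g g1 g2 h h1 h2 s₀ s₁) (hK : IsCSCD K) (ν : ι → ι)
    (hν : ∀ j, ν (ν j) = j) (hg : ∀ j t, g (ν j) t = -g j t) (hh : ∀ j t, h (ν j) t = -h j t)
    (hh1 : ∀ j t, h1 (ν j) t = -h1 j t) : IsCSCD (body K g h h1 s₀ s₁) := by
  refine ⟨S.convex_body, S.isCompact_body, ⟨0, S.zero_mem_interior_body⟩, ?_⟩
  have hL : ∀ j p, chordSide (g (ν j) s₀) (g (ν j) s₁) (-p) = chordSide (g j s₀) (g j s₁) p := by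
    intro j p
    rw [hg, hg]
    simp only [chordSide, wedge, Prod.fst_sub, Prod.snd_sub, Prod.fst_neg, Prod.snd_neg]
    ring
  have key : ∀ p ∈ body K g h h1 s₀ s₁, -p ∈ body K g h h1 s₀ s₁ := by
    rintro p (hp | hp)
    · refine Or.inl ⟨hK.neg_mem hp.1, fun j => ?_⟩
      have := hL (ν j) p
      rw [hν] at this
      exact this.trans_lt (hp.2 (ν j))
    · obtain ⟨j, hj⟩ := Set.mem_iUnion.1 hp
      refine cap_subset_body (ν j) ⟨?_, fun t ht => ?_⟩
      · have := S.chordSide_nonneg' hj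
        rw [← hL, chordSide] at this
        rwa [S.left_eq, S.right_eq]
      · have := hj.2 t ht
        rw [hh, hh1, wedge_neg_left, ← wedge_neg_right]
        convert this using 2
        abel
  ext p
  exact ⟨fun hp => key p hp, fun hp => by simpa using key _ hp⟩

end Surgery

theorem IsCSCD.neg_mem_frontier {K : Set (ℝ × ℝ)} (hK : IsCSCD K) {p : ℝ × ℝ}
    (hp : p ∈ frontier K) : -p ∈ frontier K :=
  ⟨subset_closure (hK.neg_mem (hK.2.1.isClosed.frontier_subset hp)), fun hi =>
    notMem_interior_of_mem_frontier hp (by simpa using hK.neg_mem_interior hi)⟩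

/-- A `C²` curve of nonvanishing curvature on the boundary of `K`, with its derivatives. -/
structure IsBoundaryCurve (K : Set (ℝ × ℝ)) (γ γ1 γ2 : ℝ → ℝ × ℝ) : Prop where
  hasDerivAt : ∀ t, HasDerivAt γ (γ1 t) t
  hasDerivAt' : ∀ t, HasDerivAt γ1 (γ2 t) t
  mem_frontier : ∀ t, γ t ∈ frontier K
  curvature_ne : ∀ t, wedge (γ1 t) (γ2 t) ≠ 0

namespace IsBoundaryCurve

variable {K : Set (ℝ × ℝ)} {γ γ1 γ2 : ℝ → ℝ × ℝ}

theorem mem (h : IsBoundaryCurve K γ γ1 γ2) (hK : IsCSCD K) (t : ℝ) : γ t ∈ K :=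
  hK.2.1.isClosed.frontier_subset (h.mem_frontier t)

theorem support (h : IsBoundaryCurve K γ γ1 γ2) (hK : IsCSCD K) (t : ℝ) :
    wedge (γ t) (γ1 t) ≠ 0 ∧
      ∀ p ∈ K, 0 ≤ wedge (γ t) (γ1 t) * wedge (γ1 t) (p - γ t) := by
  have h0 := hK.zero_mem_interior
  obtain ⟨f, hf⟩ := geometric_hahn_banach_open_point hK.1.interior isOpen_interior
    (notMem_interior_of_mem_frontier (h.mem_frontier t))
  have hpos : 0 < f (γ t) := by simpa using hf 0 h0
  have hle : ∀ p ∈ K, f p ≤ f (γ t) := by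
    intro p hp
    by_contra! hlt
    have hp0 : 0 < f p := hpos.trans hlt
    have := hf _ (smul_mem_interior hK.1 h0 hp (t := f (γ t) / f p) (by positivity)
      ((div_lt_one hp0).2 hlt))
    rw [map_smul, smul_eq_mul, div_mul_cancel₀ _ hp0.ne'] at this
    exact lt_irrefl _ this
  have hd : HasDerivAt (fun s => f (γ s)) (f (γ1 t)) t :=
    f.hasFDerivAt.comp_hasDerivAt t (h.hasDerivAt t)
  have hmax : IsLocalMax (fun s => f (γ s)) t :=
    Filter.Eventually.of_forall fun s => hle _ (h.mem hK s)
  have hf1 : f (γ1 t) = 0 := hmax.hasDerivAt_eq_zero hd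
  have hne : γ1 t ≠ 0 := left_ne_zero_of_wedge_ne_zero (h.curvature_ne t)
  have key : ∀ p : ℝ × ℝ, wedge (γ t) (γ1 t) * f p = wedge p (γ1 t) * f (γ t) := by
    intro p
    have : wedge (γ t) (γ1 t) • p = wedge p (γ1 t) • γ t + wedge (γ t) p • γ1 t := by
      ext <;> simp [wedge] <;> ring
    have := congrArg f this
    simpa [hf1] using this
  have hκ : wedge (γ t) (γ1 t) ≠ 0 := by
    intro hκ
    have e1 := key (1, 0)
    have e2 := key (0, 1)
    rw [hκ, zero_mul] at e1 e2
    refine hne (Prod.ext ?_ ?_)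
    · rcases mul_eq_zero.1 e2.symm with h | h
      · simpa [wedge] using h
      · exact absurd h hpos.ne'
    · rcases mul_eq_zero.1 e1.symm with h | h
      · simpa [wedge] using h
      · exact absurd h hpos.ne'
  refine ⟨hκ, fun p hp => ?_⟩
  have h1 := key p
  have h2 := hle p hp
  rw [wedge_sub_right, wedge_swap (γ1 t) p, wedge_swap (γ1 t) (γ t)]
  set κ := wedge (γ t) (γ1 t)
  have h3 : 0 ≤ κ * (κ - wedge p (γ1 t)) * f (γ t) := by
    have : κ * (κ - wedge p (γ1 t)) * f (γ t) = κ ^ 2 * (f (γ t) - f p) := by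
      linear_combination κ * h1
    rw [this]
    exact mul_nonneg (sq_nonneg _) (by linarith)
  have := nonneg_of_mul_nonneg_left h3 hpos
  linarith

theorem support_pos (h : IsBoundaryCurve K γ γ1 γ2) (hK : IsCSCD K) (t : ℝ) {p : ℝ × ℝ}
    (hp : p ∈ K) (hne : p ≠ γ t) : 0 < wedge (γ t) (γ1 t) * wedge (γ1 t) (p - γ t) := by
  refine lt_of_le_of_ne ((h.support hK t).2 p hp) fun h0 => ?_
  have hκ := (h.support hK t).1
  have hw : wedge (γ1 t) (p - γ t) = 0 := by
    rcases mul_eq_zero.1 h0.symm with h | h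
    · exact absurd h hκ
    · exact h
  have hmin : IsLocalMin (fun s => wedge (γ s) (γ1 s) * wedge (γ1 s) (p - γ s)) t :=
    Filter.Eventually.of_forall fun s => by
      simp only
      rw [← h0]
      exact (h.support hK s).2 p hp
  have hd := ((h.hasDerivAt t).wedge (h.hasDerivAt' t)).mul
    ((h.hasDerivAt' t).wedge ((h.hasDerivAt t).const_sub p))
  have hz := hmin.hasDerivAt_eq_zero hd
  rw [hw, wedge_neg_right, wedge_self] at hz
  have hne1 : γ1 t ≠ 0 := left_ne_zero_of_wedge_ne_zero (h.curvature_ne t)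
  obtain ⟨x, hx⟩ := exists_eq_smul_of_wedge_eq_zero hne1 hw
  rw [hx, wedge_smul_right, wedge_swap] at hz
  have hx0 : x ≠ 0 := by
    rintro rfl
    rw [zero_smul, sub_eq_zero] at hx
    exact hne hx
  have := h.curvature_ne t
  have hprod : wedge (γ t) (γ1 t) * (x * wedge (γ1 t) (γ2 t)) ≠ 0 :=
    mul_ne_zero hκ (mul_ne_zero hx0 this)
  apply hprod
  rw [wedge_swap (γ2 t) (γ1 t)] at hz
  simp at hz
  rcases hz with hz | hz | hz <;> simp_all

theorem curvature_pos (h : IsBoundaryCurve K γ γ1 γ2) (hK : IsCSCD K) {t : ℝ}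
    (hκ : 0 < wedge (γ t) (γ1 t)) : 0 < wedge (γ1 t) (γ2 t) := by
  by_contra! hle
  have hneg := lt_of_le_of_ne hle (h.curvature_ne t)
  set F : ℝ → ℝ := fun s => wedge (γ1 t) (γ s - γ t) with hF
  have hd : ∀ s, HasDerivAt F (wedge (γ1 t) (γ1 s)) s := fun s =>
    ((h.hasDerivAt s).sub_const (γ t)).const_wedge (γ1 t)
  have hd' : deriv F = fun s => wedge (γ1 t) (γ1 s) := funext fun s => (hd s).deriv
  have hdd : deriv (deriv F) t = wedge (γ1 t) (γ2 t) := by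
    rw [hd']
    exact ((h.hasDerivAt' t).const_wedge (γ1 t)).deriv
  have hmax : IsLocalMax F t := isLocalMax_of_deriv_deriv_neg (by rw [hdd]; exact hneg)
    (by rw [hd']; exact wedge_self _) (hd t).continuousAt
  have hFt : F t = 0 := by simp [hF, wedge]
  have hev : F =ᶠ[nhds t] fun _ => 0 := by
    filter_upwards [hmax] with s hs
    rw [hFt] at hs
    refine le_antisymm hs ?_
    have := (h.support hK t).2 _ (h.mem hK s)
    exact nonneg_of_mul_nonneg_right this hκ
  have := hev.deriv.deriv.eq_of_nhds
  rw [hdd] at this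
  simp at this
  exact h.curvature_ne t this

theorem neg (h : IsBoundaryCurve K γ γ1 γ2) (hK : IsCSCD K) :
    IsBoundaryCurve K (-γ) (-γ1) (-γ2) where
  hasDerivAt t := (h.hasDerivAt t).neg
  hasDerivAt' t := (h.hasDerivAt' t).neg
  mem_frontier t :=
    hK.neg_mem_frontier (h.mem_frontier t)
  curvature_ne t := by
    simpa [wedge] using h.curvature_ne t

theorem reverse (h : IsBoundaryCurve K γ γ1 γ2) :
    IsBoundaryCurve K (fun t => γ (-t)) (fun t => -γ1 (-t)) (fun t => γ2 (-t)) where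
  hasDerivAt t := by
    have := (h.hasDerivAt (-t)).scomp t (hasDerivAt_neg t)
    exact this.congr_deriv (by simp)
  hasDerivAt' t := by
    have := ((h.hasDerivAt' (-t)).scomp t (hasDerivAt_neg t)).neg
    exact this.congr_deriv (by simp)
  mem_frontier t := h.mem_frontier (-t)
  curvature_ne t := by
    rw [wedge_neg_left, neg_ne_zero]
    exact h.curvature_ne (-t)

end IsBoundaryCurve

/-- Three boundary curves `a`, `b`, `a + b` that, with their negatives, form a multi-curve. -/
structure IsHexCurve (K : Set (ℝ × ℝ)) (c : ℝ) (a a1 a2 b b1 b2 : ℝ → ℝ × ℝ) : Prop where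
  pos : 0 < c
  wedge_eq : ∀ t, wedge (a t) (b t) = c
  left : IsBoundaryCurve K a a1 a2
  right : IsBoundaryCurve K b b1 b2
  add : IsBoundaryCurve K (a + b) (a1 + b1) (a2 + b2)
  cont_left : Continuous a2
  cont_right : Continuous b2

namespace IsHexCurve

variable {K : Set (ℝ × ℝ)} {c : ℝ} {a a1 a2 b b1 b2 : ℝ → ℝ × ℝ}

theorem reverse (h : IsHexCurve K c a a1 a2 b b1 b2) :
    IsHexCurve K c (fun t => a (-t)) (fun t => -a1 (-t)) (fun t => a2 (-t))
      (fun t => b (-t)) (fun t => -b1 (-t)) (fun t => b2 (-t)) where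
  pos := h.pos
  wedge_eq t := h.wedge_eq (-t)
  left := h.left.reverse
  right := h.right.reverse
  add := by
    have := h.add.reverse
    convert this using 1
    · rfl
    · funext t
      simp [add_comm]
    · rfl
  cont_left := h.cont_left.comp continuous_neg
  cont_right := h.cont_right.comp continuous_neg

theorem wedge_deriv_eq (h : IsHexCurve K c a a1 a2 b b1 b2) (t : ℝ) :
    wedge (a1 t) (b t) + wedge (a t) (b1 t) = 0 := by
  have hd := (h.left.hasDerivAt t).wedge (h.right.hasDerivAt t)
  have : (fun t => wedge (a t) (b t)) = fun _ => c := funext h.wedge_eq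
  rw [this] at hd
  exact hd.unique (hasDerivAt_const t c)

/-- All curves are traversed in the same sense. -/
theorem all_pos (h : IsHexCurve K c a a1 a2 b b1 b2) (hK : IsCSCD K) {t : ℝ}
    (hpos : 0 < wedge (a t) (a1 t)) :
    0 < wedge (b t) (b1 t) ∧ 0 < wedge ((a + b) t) ((a1 + b1) t) := by
  have hc := h.wedge_eq t
  have hc0 := h.pos
  have hw := h.wedge_deriv_eq t
  have hb0 : b t ≠ 0 := by
    intro h0
    rw [h0] at hc
    simp [wedge] at hc
    linarith
  have ha0 : a t ≠ 0 := by
    intro h0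
    rw [h0] at hc
    simp [wedge] at hc
    linarith
  have hab0 : -b t ≠ a t := by
    intro h0
    rw [← h0] at hc
    simp [wedge] at hc
    linarith
  have habK := h.add.mem hK t
  have h1 := h.left.support_pos hK t habK (by simpa using hb0)
  have h2 := h.left.support_pos hK t (hK.neg_mem (h.right.mem hK t)) hab0
  have h3 := h.right.support_pos hK t habK (by simpa using ha0)
  have h4 := h.add.support_pos hK t (h.right.mem hK t) (by simpa using ha0)
  have e1 : wedge (a1 t) ((a + b) t - a t) = wedge (a1 t) (b t) := by simp
  have e2 : wedge (a1 t) (-b t - a t) = wedge (a t) (a1 t) - wedge (a1 t) (b t) := by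
    simp [wedge]; ring
  have e3 : wedge (b1 t) ((a + b) t - b t) = wedge (a1 t) (b t) := by
    rw [show wedge (a1 t) (b t) = -wedge (a t) (b1 t) by linarith, Pi.add_apply,
      add_sub_cancel_right, wedge_swap]
  have e4 : wedge ((a1 + b1) t) (b t - (a + b) t) =
      wedge (a t) (a1 t) - wedge (a1 t) (b t) := by
    rw [show wedge (a1 t) (b t) = -wedge (a t) (b1 t) by linarith]
    simp [wedge]; ring
  rw [e1] at h1
  rw [e2] at h2
  rw [e3] at h3
  rw [e4] at h4
  have f1 := (mul_pos_iff_of_pos_left hpos).1 h1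
  have f2 := (mul_pos_iff_of_pos_left hpos).1 h2
  exact ⟨(mul_pos_iff_of_pos_right f1).1 h3, (mul_pos_iff_of_pos_right f2).1 h4⟩

end IsHexCurve

/-- The first coordinates of the vertices of the affine regular hexagon. -/
def hexLeft : Fin 6 → ℝ := ![1, 1, 0, -1, -1, 0]

/-- The second coordinates of the vertices of the affine regular hexagon. -/
def hexRight : Fin 6 → ℝ := ![0, 1, 1, 0, -1, -1]

/-- The six curves `a, a + b, b, -a, -a - b, -b`. -/
def hex (a b : ℝ → ℝ × ℝ) (j : Fin 6) (t : ℝ) : ℝ × ℝ := hexLeft j • a t + hexRight j • b t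

theorem hexLeft_add_three (j : Fin 6) : hexLeft (j + 3) = -hexLeft j := by
  fin_cases j <;> simp [hexLeft]

theorem hexRight_add_three (j : Fin 6) : hexRight (j + 3) = -hexRight j := by
  fin_cases j <;> simp [hexRight]

theorem hex_add_three (a b : ℝ → ℝ × ℝ) (j : Fin 6) : hex a b (j + 3) = -hex a b j := by
  funext t
  simp only [hex, hexLeft_add_three, hexRight_add_three, Pi.neg_apply]
  module

theorem hex_zero (a b : ℝ → ℝ × ℝ) : hex a b 0 = a := by
  funext t; simp [hex, hexLeft, hexRight]

theorem hex_one (a b : ℝ → ℝ × ℝ) : hex a b 1 = a + b := by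
  funext t; simp [hex, hexLeft, hexRight]

theorem hex_two (a b : ℝ → ℝ × ℝ) : hex a b 2 = b := by
  funext t; simp [hex, hexLeft, hexRight]

theorem hex_add_hex (a b : ℝ → ℝ × ℝ) (j : Fin 6) (t : ℝ) :
    hex a b (j + 2) t + hex a b j t = hex a b (j + 1) t := by
  fin_cases j <;> simp [hex, hexLeft, hexRight, add_comm]

theorem wedge_hex (a b : ℝ → ℝ × ℝ) (j : Fin 6) (t : ℝ) :
    wedge (hex a b j t) (hex a b (j + 2) t) = wedge (a t) (b t) := by
  fin_cases j <;> simp [hex, hexLeft, hexRight, wedge] <;> ring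

theorem hex_induction {P : Fin 6 → Prop} (h0 : P 0) (h1 : P 1) (h2 : P 2)
    (hn : ∀ j, P j → P (j + 3)) : ∀ j, P j := by
  intro j
  fin_cases j
  exacts [h0, h1, h2, hn 0 h0, hn 1 h1, hn 2 h2]

theorem hex_injective {a b : ℝ → ℝ × ℝ} {t : ℝ} (hw : wedge (a t) (b t) ≠ 0) {i j : Fin 6}
    (h : hex a b i t = hex a b j t) : i = j := by
  have h0 : (hexLeft i - hexLeft j) • a t + (hexRight i - hexRight j) • b t = 0 := by
    rw [← sub_eq_zero] at h
    rw [← h, hex, hex]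
    module
  obtain ⟨h1, h2⟩ := coord_eq_zero_of_wedge_ne_zero hw h0
  revert h1 h2
  fin_cases i <;> fin_cases j <;> simp [hexLeft, hexRight] <;> norm_num

theorem hasDerivAt_hex {a a1 b b1 : ℝ → ℝ × ℝ} {t : ℝ} (ha : HasDerivAt a (a1 t) t)
    (hb : HasDerivAt b (b1 t) t) (j : Fin 6) : HasDerivAt (hex a b j) (hex a1 b1 j t) t :=
  (ha.const_smul (hexLeft j)).add (hb.const_smul (hexRight j))

namespace IsHexCurve

variable {K : Set (ℝ × ℝ)} {c : ℝ} {a a1 a2 b b1 b2 : ℝ → ℝ × ℝ}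

theorem isBoundaryCurve (h : IsHexCurve K c a a1 a2 b b1 b2) (hK : IsCSCD K) (j : Fin 6) :
    IsBoundaryCurve K (hex a b j) (hex a1 b1 j) (hex a2 b2 j) := by
  refine hex_induction (P := fun j => IsBoundaryCurve K (hex a b j) (hex a1 b1 j) (hex a2 b2 j))
    ?_ ?_ ?_ ?_ j
  · simpa only [hex_zero] using h.left
  · simpa only [hex_one] using h.add
  · simpa only [hex_two] using h.right
  · intro j hj
    simpa only [hex_add_three] using hj.neg hK

theorem wedge_deriv_pos (h : IsHexCurve K c a a1 a2 b b1 b2) (hK : IsCSCD K) {t : ℝ}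
    (hpos : 0 < wedge (a t) (a1 t)) (j : Fin 6) : 0 < wedge (hex a b j t) (hex a1 b1 j t) := by
  refine hex_induction (P := fun j => 0 < wedge (hex a b j t) (hex a1 b1 j t)) ?_ ?_ ?_ ?_ j
  · simpa only [hex_zero] using hpos
  · simpa only [hex_one] using (h.all_pos hK hpos).2
  · simpa only [hex_two] using (h.all_pos hK hpos).1
  · intro j hj
    simpa [hex_add_three, wedge] using hj

theorem continuous_left (h : IsHexCurve K c a a1 a2 b b1 b2) : Continuous a :=
  continuous_iff_continuousAt.2 fun t => (h.left.hasDerivAt t).continuousAt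

theorem continuous_left' (h : IsHexCurve K c a a1 a2 b b1 b2) : Continuous a1 :=
  continuous_iff_continuousAt.2 fun t => (h.left.hasDerivAt' t).continuousAt

theorem continuous_right (h : IsHexCurve K c a a1 a2 b b1 b2) : Continuous b :=
  continuous_iff_continuousAt.2 fun t => (h.right.hasDerivAt t).continuousAt

theorem continuous_right' (h : IsHexCurve K c a a1 a2 b b1 b2) : Continuous b1 :=
  continuous_iff_continuousAt.2 fun t => (h.right.hasDerivAt' t).continuousAt

theorem _root_.continuous_hex {a b : ℝ → ℝ × ℝ} (ha : Continuous a) (hb : Continuous b)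
    (j : Fin 6) : Continuous (hex a b j) :=
  (ha.const_smul (hexLeft j)).add (hb.const_smul (hexRight j))

/-- Near a point where all curves turn left, the position conditions for a surgery hold. -/
theorem exists_window (h : IsHexCurve K c a a1 a2 b b1 b2) (hK : IsCSCD K)
    (hpos : 0 < wedge (a 0) (a1 0)) :
    ∃ δ > 0, ∀ τ ∈ Set.Icc 0 δ, ∀ t ∈ Set.Icc 0 δ, ∀ s ∈ Set.Icc 0 δ, ∀ i,
      0 < wedge (hex a1 b1 i τ) (hex a2 b2 i t) ∧ 0 < wedge (hex a1 b1 i τ) (-hex a b i s) ∧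
      ∀ j, i ≠ j → 0 < wedge (hex a1 b1 i τ) (hex a b j t - hex a b i s) := by
  have c0 := fun j => continuous_hex h.continuous_left h.continuous_right j
  have c1 := fun j => continuous_hex h.continuous_left' h.continuous_right' j
  have c2 := fun j => continuous_hex h.cont_left h.cont_right j
  have hw : wedge (a 0) (b 0) ≠ 0 := by rw [h.wedge_eq]; exact h.pos.ne'
  have hev : ∀ᶠ q : ℝ × ℝ × ℝ in nhds 0, ∀ i,
      0 < wedge (hex a1 b1 i q.1) (hex a2 b2 i q.2.1) ∧
      0 < wedge (hex a1 b1 i q.1) (-hex a b i q.2.2) ∧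
      ∀ j, i ≠ j → 0 < wedge (hex a1 b1 i q.1) (hex a b j q.2.1 - hex a b i q.2.2) := by
    refine Filter.eventually_all.2 fun i => ?_
    have hi := h.isBoundaryCurve hK i
    have hκ := h.wedge_deriv_pos hK hpos i
    refine Filter.Eventually.and ?_ (Filter.Eventually.and ?_ (Filter.eventually_all.2 fun j => ?_))
    · have hc : Continuous fun q : ℝ × ℝ × ℝ => wedge (hex a1 b1 i q.1) (hex a2 b2 i q.2.1) :=
        ((c1 i).comp continuous_fst).wedge ((c2 i).comp (continuous_fst.comp continuous_snd))
      exact hc.continuousAt.eventually (lt_mem_nhds (hi.curvature_pos hK hκ))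
    · have hc : Continuous fun q : ℝ × ℝ × ℝ => wedge (hex a1 b1 i q.1) (-hex a b i q.2.2) :=
        ((c1 i).comp continuous_fst).wedge
          ((c0 i).comp (continuous_snd.comp continuous_snd)).neg
      refine hc.continuousAt.eventually (lt_mem_nhds ?_)
      change 0 < wedge (hex a1 b1 i 0) (-hex a b i 0)
      rw [wedge_neg_right, ← wedge_swap]
      exact hκ
    · by_cases hij : i = j
      · exact Filter.Eventually.of_forall fun _ hne => absurd hij hne
      · have hc : Continuous fun q : ℝ × ℝ × ℝ =>
            wedge (hex a1 b1 i q.1) (hex a b j q.2.1 - hex a b i q.2.2) :=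
          ((c1 i).comp continuous_fst).wedge
            (((c0 j).comp (continuous_fst.comp continuous_snd)).sub
              ((c0 i).comp (continuous_snd.comp continuous_snd)))
        have := hi.support_pos hK 0 ((h.isBoundaryCurve hK j).mem hK 0)
          (fun he => hij (hex_injective hw he.symm))
        filter_upwards [hc.continuousAt.eventually
          (lt_mem_nhds ((mul_pos_iff_of_pos_left hκ).1 this))] with q hq _ using hq
  obtain ⟨δ, hδ, hball⟩ := Metric.eventually_nhds_iff.1 hev
  refine ⟨δ / 2, by positivity, fun τ hτ t ht s hs => ?_⟩
  refine hball (y := (τ, t, s)) ?_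
  have key : ∀ x ∈ Set.Icc 0 (δ / 2), |x| < δ := fun x hx => by
    rw [abs_of_nonneg hx.1]; linarith [hx.2]
  rw [dist_zero_right, Prod.norm_def, Prod.norm_def]
  simp only [Real.norm_eq_abs]
  exact max_lt (key τ hτ) (max_lt (key t ht) (key s hs))

end IsHexCurve

/-- The curve `v + f w`. -/
def shear (f : ℝ → ℝ) (v w : ℝ → ℝ × ℝ) (t : ℝ) : ℝ × ℝ := v t + f t • w t

/-- The derivative of `v + f w`. -/
def shear1 (f f1 : ℝ → ℝ) (v1 w w1 : ℝ → ℝ × ℝ) (t : ℝ) : ℝ × ℝ :=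
  v1 t + (f1 t • w t + f t • w1 t)

/-- The second derivative of `v + f w`. -/
def shear2 (f f1 f2 : ℝ → ℝ) (v2 w w1 w2 : ℝ → ℝ × ℝ) (t : ℝ) : ℝ × ℝ :=
  v2 t + (f2 t • w t + (2 * f1 t) • w1 t + f t • w2 t)

theorem hasDerivAt_shear {f f1 : ℝ → ℝ} {v v1 w w1 : ℝ → ℝ × ℝ} {t : ℝ}
    (hf : HasDerivAt f (f1 t) t) (hv : HasDerivAt v (v1 t) t) (hw : HasDerivAt w (w1 t) t) :
    HasDerivAt (shear f v w) (shear1 f f1 v1 w w1 t) t :=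
  HasDerivAt.congr_deriv (hv.add (hf.smul hw)) (by rw [shear1]; module)

theorem hasDerivAt_shear1 {f f1 f2 : ℝ → ℝ} {v1 v2 w w1 w2 : ℝ → ℝ × ℝ} {t : ℝ}
    (hf : HasDerivAt f (f1 t) t) (hf1 : HasDerivAt f1 (f2 t) t) (hv : HasDerivAt v1 (v2 t) t)
    (hw : HasDerivAt w (w1 t) t) (hw1 : HasDerivAt w1 (w2 t) t) :
    HasDerivAt (shear1 f f1 v1 w w1) (shear2 f f1 f2 v2 w w1 w2 t) t :=
  HasDerivAt.congr_deriv (hv.add ((hf1.smul hw).add (hf.smul hw1))) (by rw [shear2]; module)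

/-- A polynomial vanishing to second order at `0` and `δ`. -/
def bump (δ t : ℝ) : ℝ := t ^ 2 * (δ - t) ^ 2

/-- The derivative of `bump`. -/
def bump1 (δ t : ℝ) : ℝ := 2 * t * (δ - t) * (δ - 2 * t)

/-- The second derivative of `bump`. -/
def bump2 (δ t : ℝ) : ℝ := 2 * δ ^ 2 - 12 * δ * t + 12 * t ^ 2

/-- The bump with an extra factor increasing from `0` to `1`. -/
def ramp (δ t : ℝ) : ℝ := t / δ * bump δ t

/-- The derivative of `ramp`. -/
def ramp1 (δ t : ℝ) : ℝ := bump δ t / δ + t / δ * bump1 δ t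

/-- The second derivative of `ramp`. -/
def ramp2 (δ t : ℝ) : ℝ := 2 * bump1 δ t / δ + t / δ * bump2 δ t

theorem hasDerivAt_bump (δ t : ℝ) : HasDerivAt (bump δ) (bump1 δ t) t :=
  (((hasDerivAt_id t).pow 2).mul (((hasDerivAt_id t).const_sub δ).pow 2)).congr_deriv
    (by simp [bump1]; ring)

theorem hasDerivAt_bump1 (δ t : ℝ) : HasDerivAt (bump1 δ) (bump2 δ t) t :=
  ((((hasDerivAt_id t).const_mul 2).mul ((hasDerivAt_id t).const_sub δ)).mul
    (((hasDerivAt_id t).const_mul 2).const_sub δ)).congr_deriv (by simp [bump2]; ring)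

theorem hasDerivAt_ramp (δ t : ℝ) : HasDerivAt (ramp δ) (ramp1 δ t) t :=
  (((hasDerivAt_id t).div_const δ).mul (hasDerivAt_bump δ t)).congr_deriv
    (by simp [ramp1]; ring)

theorem hasDerivAt_ramp1 (δ t : ℝ) : HasDerivAt (ramp1 δ) (ramp2 δ t) t :=
  (((hasDerivAt_bump δ t).div_const δ).add
    (((hasDerivAt_id t).div_const δ).mul (hasDerivAt_bump1 δ t))).congr_deriv
    (by simp [ramp2]; ring)

theorem continuous_bump (δ : ℝ) : Continuous (bump δ) := by unfold bump; fun_prop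

theorem continuous_bump1 (δ : ℝ) : Continuous (bump1 δ) := by unfold bump1; fun_prop

theorem continuous_bump2 (δ : ℝ) : Continuous (bump2 δ) := by unfold bump2; fun_prop

theorem continuous_ramp (δ : ℝ) : Continuous (ramp δ) := by unfold ramp bump; fun_prop

theorem continuous_ramp1 (δ : ℝ) : Continuous (ramp1 δ) := by unfold ramp1 bump bump1; fun_prop

theorem continuous_ramp2 (δ : ℝ) : Continuous (ramp2 δ) := by unfold ramp2 bump1 bump2; fun_prop

/-- The perturbation of `a`. -/
def tiltLeft (ε δ : ℝ) (a b : ℝ → ℝ × ℝ) : ℝ → ℝ × ℝ := shear (fun t => ε * bump δ t) a b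

/-- The derivative of `tiltLeft`. -/
def tiltLeft1 (ε δ : ℝ) (a1 b b1 : ℝ → ℝ × ℝ) : ℝ → ℝ × ℝ :=
  shear1 (fun t => ε * bump δ t) (fun t => ε * bump1 δ t) a1 b b1

/-- The second derivative of `tiltLeft`. -/
def tiltLeft2 (ε δ : ℝ) (a2 b b1 b2 : ℝ → ℝ × ℝ) : ℝ → ℝ × ℝ :=
  shear2 (fun t => ε * bump δ t) (fun t => ε * bump1 δ t) (fun t => ε * bump2 δ t) a2 b b1 b2

/-- The perturbation of `b`. -/
def tiltRight (ε δ : ℝ) (a b : ℝ → ℝ × ℝ) : ℝ → ℝ × ℝ :=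
  shear (fun t => ε * ramp δ t) b (tiltLeft ε δ a b)

/-- The derivative of `tiltRight`. -/
def tiltRight1 (ε δ : ℝ) (a a1 b b1 : ℝ → ℝ × ℝ) : ℝ → ℝ × ℝ :=
  shear1 (fun t => ε * ramp δ t) (fun t => ε * ramp1 δ t) b1 (tiltLeft ε δ a b)
    (tiltLeft1 ε δ a1 b b1)

/-- The second derivative of `tiltRight`. -/
def tiltRight2 (ε δ : ℝ) (a a1 a2 b b1 b2 : ℝ → ℝ × ℝ) : ℝ → ℝ × ℝ :=
  shear2 (fun t => ε * ramp δ t) (fun t => ε * ramp1 δ t) (fun t => ε * ramp2 δ t) b2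
    (tiltLeft ε δ a b) (tiltLeft1 ε δ a1 b b1) (tiltLeft2 ε δ a2 b b1 b2)

theorem wedge_tilt (ε δ : ℝ) (a b : ℝ → ℝ × ℝ) (t : ℝ) :
    wedge (tiltLeft ε δ a b t) (tiltRight ε δ a b t) = wedge (a t) (b t) := by
  simp only [tiltLeft, tiltRight, shear, wedge, Prod.fst_add, Prod.snd_add, Prod.smul_fst,
    Prod.smul_snd, smul_eq_mul]
  ring

/-- Twice the rate at which the three curves `a`, `b`, `a + b` sweep out area. -/
def sweep (a a1 b b1 : ℝ → ℝ × ℝ) (t : ℝ) : ℝ :=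
  wedge (a t) (a1 t) + wedge (b t) (b1 t) + wedge (a t + b t) (a1 t + b1 t)

/-- The area variation as a polynomial in the perturbation. -/
theorem sweep_tilt {ε δ t : ℝ} {a a1 b b1 : ℝ → ℝ × ℝ}
    (h : wedge (a1 t) (b t) + wedge (a t) (b1 t) = 0) :
    sweep (tiltLeft ε δ a b) (tiltLeft1 ε δ a1 b b1) (tiltRight ε δ a b)
      (tiltRight1 ε δ a a1 b b1) t - sweep a a1 b b1 t =
      ε * (2 * wedge (a t) (b t) * (bump1 δ t - ramp1 δ t)
        + 4 * (bump δ t + ramp δ t) * wedge (a t) (b1 t)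
        + 2 * bump δ t * wedge (b t) (b1 t) + 2 * ramp δ t * wedge (a t) (a1 t))
      + ε ^ 2 * (2 * bump δ t ^ 2 * wedge (b t) (b1 t)
        + 4 * bump δ t * ramp δ t * wedge (b t) (b1 t) + 2 * ramp δ t ^ 2 * wedge (a t) (a1 t)
        + 2 * wedge (a t) (b t) * ramp δ t * bump1 δ t
        + 4 * bump δ t * ramp δ t * wedge (a t) (b1 t))
      + ε ^ 3 * (2 * wedge (a t) (b t) * ramp δ t ^ 2 * bump1 δ t
        + 4 * bump δ t * ramp δ t ^ 2 * wedge (a t) (b1 t)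
        + 2 * bump δ t ^ 2 * ramp δ t * wedge (b t) (b1 t))
      + ε ^ 4 * (2 * bump δ t ^ 2 * ramp δ t ^ 2 * wedge (b t) (b1 t)) := by
  simp only [sweep, tiltLeft, tiltRight, tiltLeft1, tiltRight1, shear, shear1, wedge,
    Prod.fst_add, Prod.snd_add, Prod.smul_fst, Prod.smul_snd, smul_eq_mul] at h ⊢
  linear_combination (-(2 * (ε * bump δ t) + 2 * (ε * ramp δ t)
    + 2 * (ε * ramp δ t) ^ 2 * (ε * bump δ t) + 2 * (ε * ramp δ t) * (ε * bump δ t))) * h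

theorem exists_quartic_neg {e1 e2 e3 e4 : ℝ} (h : e2 < 0) {η : ℝ} (hη : 0 < η) :
    ∃ ε, |ε| < η ∧ ε * e1 + ε ^ 2 * e2 + ε ^ 3 * e3 + ε ^ 4 * e4 < 0 := by
  obtain ⟨r, hr0, hrη, hr1, hr⟩ : ∃ r, 0 < r ∧ r < η ∧ r ≤ 1 ∧ r * (|e3| + |e4|) < -e2 := by
    have hd : 0 < |e3| + |e4| + 1 := by positivity
    have hq : 0 < -e2 / (|e3| + |e4| + 1) := div_pos (by linarith) hd
    refine ⟨min (η / 2) (min 1 (-e2 / (|e3| + |e4| + 1))), by positivity,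
      (min_le_left _ _).trans_lt (by linarith), (min_le_right _ _).trans (min_le_left _ _), ?_⟩
    set r := min (η / 2) (min 1 (-e2 / (|e3| + |e4| + 1))) with hr
    have h1 : 0 < r := by positivity
    have h2 : r ≤ -e2 / (|e3| + |e4| + 1) := (min_le_right _ _).trans (min_le_right _ _)
    rw [le_div_iff₀ hd] at h2
    linarith
  have key : ∀ ε, |ε| = r → ε * e1 ≤ 0 →
      ε * e1 + ε ^ 2 * e2 + ε ^ 3 * e3 + ε ^ 4 * e4 < 0 := by
    intro ε hε h1
    have h2 : ε * e3 ≤ r * |e3| := by rw [← hε, ← abs_mul]; exact le_abs_self _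
    have h3 : ε ^ 2 * e4 ≤ r * |e4| := by
      have : ε ^ 2 = r ^ 2 := by rw [← hε, sq_abs]
      rw [this]
      nlinarith [le_abs_self e4, abs_nonneg e4, mul_nonneg hr0.le (abs_nonneg e4)]
    have h4 : 0 < ε ^ 2 := by rw [← sq_abs, hε]; positivity
    have h5 : ε ^ 2 * (e2 + ε * e3 + ε ^ 2 * e4) < 0 := mul_neg_of_pos_of_neg h4 (by linarith)
    nlinarith
  rcases le_total e1 0 with h1 | h1
  · exact ⟨r, by rwa [abs_of_pos hr0], key r (abs_of_pos hr0) (by nlinarith)⟩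
  · exact ⟨-r, by rwa [abs_neg, abs_of_pos hr0], key _ (by rw [abs_neg, abs_of_pos hr0])
      (by nlinarith)⟩

/-- Without the total derivative of `t * bump δ t ^ 2`, the second variation of the area is
negative for small `δ`. -/
theorem second_variation_neg {a a1 b b1 : ℝ → ℝ × ℝ} (ha : Continuous a) (ha1 : Continuous a1)
    (hb : Continuous b) (hb1 : Continuous b1) {c C δ : ℝ} (hδ : 0 < δ) (hC : C * δ < c)
    (hw : ∀ t, wedge (a t) (b t) = c)
    (hbound : ∀ t ∈ Set.Icc 0 δ, 6 * |wedge (b t) (b1 t)| + 2 * |wedge (a t) (a1 t)|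
      + 4 * |wedge (a t) (b1 t)| ≤ C) :
    ∫ t in (0 : ℝ)..δ, (2 * bump δ t ^ 2 * wedge (b t) (b1 t)
        + 4 * bump δ t * ramp δ t * wedge (b t) (b1 t) + 2 * ramp δ t ^ 2 * wedge (a t) (a1 t)
        + 2 * wedge (a t) (b t) * ramp δ t * bump1 δ t
        + 4 * bump δ t * ramp δ t * wedge (a t) (b1 t)) < 0 := by
  have cX := continuous_bump δ
  have cX1 := continuous_bump1 δ
  have cY := continuous_ramp δ
  have cA := ha.wedge ha1
  have cB := hb.wedge hb1
  have cM := ha.wedge hb1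
  have hd : ∀ t, HasDerivAt (fun t => t * bump δ t ^ 2)
      (bump δ t ^ 2 + t * (2 * bump δ t * bump1 δ t)) t := fun t =>
    ((hasDerivAt_id t).mul ((hasDerivAt_bump δ t).pow 2)).congr_deriv (by simp)
  have hcd : Continuous fun t => bump δ t ^ 2 + t * (2 * bump δ t * bump1 δ t) := by fun_prop
  have h0 : ∫ t in (0 : ℝ)..δ, (bump δ t ^ 2 + t * (2 * bump δ t * bump1 δ t)) = 0 := by
    rw [intervalIntegral.integral_eq_sub_of_hasDerivAt (fun t _ => hd t)
      (hcd.intervalIntegrable _ _)]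
    simp [bump]
  set e : ℝ → ℝ := fun t => 2 * bump δ t ^ 2 * wedge (b t) (b1 t)
        + 4 * bump δ t * ramp δ t * wedge (b t) (b1 t) + 2 * ramp δ t ^ 2 * wedge (a t) (a1 t)
        + 2 * wedge (a t) (b t) * ramp δ t * bump1 δ t
        + 4 * bump δ t * ramp δ t * wedge (a t) (b1 t) with he
  have hce : Continuous e := by
    simp only [he, hw]
    fun_prop
  have h1 : 0 < ∫ t in (0 : ℝ)..δ,
      (c / δ * (bump δ t ^ 2 + t * (2 * bump δ t * bump1 δ t)) - e t) := by
    refine intervalIntegral.intervalIntegral_pos_of_pos_on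
      (((hcd.const_mul _).sub hce).intervalIntegrable _ _) (fun t ht => ?_) hδ
    have hX : 0 < bump δ t := by
      have := ht.1; have := sub_pos.2 ht.2
      unfold bump; positivity
    have hr0 : 0 ≤ t / δ := div_nonneg ht.1.le hδ.le
    have hr1 : t / δ ≤ 1 := (div_le_one hδ).2 ht.2.le
    have hb' := hbound t ⟨ht.1.le, ht.2.le⟩
    set B := wedge (b t) (b1 t)
    set A := wedge (a t) (a1 t)
    set M := wedge (a t) (b1 t)
    have hCd : C < c / δ := (lt_div_iff₀ hδ).2 hC
    have hx : c / δ * (bump δ t ^ 2 + t * (2 * bump δ t * bump1 δ t)) - e t =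
        bump δ t ^ 2 * (c / δ - (2 * B + 4 * (t / δ * B) + 2 * ((t / δ) ^ 2 * A)
          + 4 * (t / δ * M))) := by
      simp only [he, hw, ramp]
      ring
    rw [hx]
    have q1 : ∀ x : ℝ, t / δ * x ≤ |x| := fun x => by
      nlinarith [le_abs_self x, abs_nonneg x, mul_nonneg hr0 (sub_nonneg.2 (le_abs_self x))]
    have q2 : (t / δ) ^ 2 * A ≤ |A| := by
      have := q1 (t / δ * A)
      rw [abs_mul, abs_of_nonneg hr0] at this
      nlinarith [q1 |A|, abs_abs A]
    refine mul_pos (by positivity) ?_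
    linarith [q1 B, q1 M, le_abs_self B]
  rw [intervalIntegral.integral_sub ((hcd.const_mul _).intervalIntegrable _ _)
    (hce.intervalIntegrable _ _), intervalIntegral.integral_const_mul, h0] at h1
  linarith

/-- On a short interval, an arbitrarily small perturbation decreases the swept area. -/
theorem IsHexCurve.exists_tilt {K : Set (ℝ × ℝ)} {c : ℝ} {a a1 a2 b b1 b2 : ℝ → ℝ × ℝ}
    (h : IsHexCurve K c a a1 a2 b b1 b2) {δ₀ : ℝ} (hδ₀ : 0 < δ₀) :
    ∃ δ > 0, δ ≤ δ₀ ∧ ∀ η > 0, ∃ ε, |ε| < η ∧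
      ∫ t in (0 : ℝ)..δ, sweep (tiltLeft ε δ a b) (tiltLeft1 ε δ a1 b b1) (tiltRight ε δ a b)
        (tiltRight1 ε δ a a1 b b1) t < ∫ t in (0 : ℝ)..δ, sweep a a1 b b1 t := by
  have ca := h.continuous_left
  have ca1 := h.continuous_left'
  have cb := h.continuous_right
  have cb1 := h.continuous_right'
  have cA := ca.wedge ca1
  have cB := cb.wedge cb1
  have cM := ca.wedge cb1
  have hcs : Continuous (sweep a a1 b b1) :=
    (cA.add cB).add ((ca.add cb).wedge (ca1.add cb1))
  obtain ⟨C, hC⟩ := (isCompact_Icc (a := (0 : ℝ)) (b := δ₀)).exists_bound_of_continuousOn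
    (f := fun t => 6 * |wedge (b t) (b1 t)| + 2 * |wedge (a t) (a1 t)|
      + 4 * |wedge (a t) (b1 t)|) (by fun_prop)
  have hC0 : 0 ≤ C := (norm_nonneg _).trans (hC 0 ⟨le_rfl, hδ₀.le⟩)
  have hc := h.pos
  refine ⟨min δ₀ (c / (C + 1)), by positivity, min_le_left _ _, fun η hη => ?_⟩
  set δ := min δ₀ (c / (C + 1)) with hδ
  have hδpos : 0 < δ := by positivity
  have hCδ : C * δ < c := by
    have : δ ≤ c / (C + 1) := min_le_right _ _
    rw [le_div_iff₀ (by positivity)] at this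
    linarith
  have cX := continuous_bump δ
  have cX1 := continuous_bump1 δ
  have cY := continuous_ramp δ
  have cY1 := continuous_ramp1 δ
  have h2 := second_variation_neg ca ca1 cb cb1 hδpos hCδ h.wedge_eq fun t ht =>
    (le_abs_self _).trans (hC t ⟨ht.1, ht.2.trans (min_le_left _ _)⟩)
  obtain ⟨ε, hε, hneg⟩ := exists_quartic_neg (e1 := ∫ t in (0 : ℝ)..δ,
      (2 * wedge (a t) (b t) * (bump1 δ t - ramp1 δ t)
        + 4 * (bump δ t + ramp δ t) * wedge (a t) (b1 t)
        + 2 * bump δ t * wedge (b t) (b1 t) + 2 * ramp δ t * wedge (a t) (a1 t)))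
    (e3 := ∫ t in (0 : ℝ)..δ, (2 * wedge (a t) (b t) * ramp δ t ^ 2 * bump1 δ t
        + 4 * bump δ t * ramp δ t ^ 2 * wedge (a t) (b1 t)
        + 2 * bump δ t ^ 2 * ramp δ t * wedge (b t) (b1 t)))
    (e4 := ∫ t in (0 : ℝ)..δ, (2 * bump δ t ^ 2 * ramp δ t ^ 2 * wedge (b t) (b1 t))) h2 hη
  refine ⟨ε, hε, ?_⟩
  simp only [h.wedge_eq] at hneg
  simp only [← intervalIntegral.integral_const_mul] at hneg
  rw [← intervalIntegral.integral_add, ← intervalIntegral.integral_add,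
    ← intervalIntegral.integral_add] at hneg
  · have hs : ∀ t, sweep (tiltLeft ε δ a b) (tiltLeft1 ε δ a1 b b1) (tiltRight ε δ a b)
        (tiltRight1 ε δ a a1 b b1) t = _ := fun t =>
      eq_add_of_sub_eq (sweep_tilt (h.wedge_deriv_eq t))
    simp only [hs, h.wedge_eq]
    rw [intervalIntegral.integral_add]
    · linarith
    · exact Continuous.intervalIntegrable (by fun_prop) _ _
    · exact hcs.intervalIntegrable _ _
  all_goals exact Continuous.intervalIntegrable (by fun_prop) _ _

section Tilt

variable {ε δ : ℝ} {a a1 a2 b b1 b2 : ℝ → ℝ × ℝ}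

theorem hasDerivAt_tiltLeft {t : ℝ} (ha : HasDerivAt a (a1 t) t) (hb : HasDerivAt b (b1 t) t) :
    HasDerivAt (tiltLeft ε δ a b) (tiltLeft1 ε δ a1 b b1 t) t :=
  hasDerivAt_shear ((hasDerivAt_bump δ t).const_mul ε) ha hb

theorem hasDerivAt_tiltLeft1 {t : ℝ} (ha : HasDerivAt a1 (a2 t) t) (hb : HasDerivAt b (b1 t) t)
    (hb1 : HasDerivAt b1 (b2 t) t) :
    HasDerivAt (tiltLeft1 ε δ a1 b b1) (tiltLeft2 ε δ a2 b b1 b2 t) t :=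
  hasDerivAt_shear1 ((hasDerivAt_bump δ t).const_mul ε) ((hasDerivAt_bump1 δ t).const_mul ε)
    ha hb hb1

theorem hasDerivAt_tiltRight {t : ℝ} (ha : HasDerivAt a (a1 t) t) (hb : HasDerivAt b (b1 t) t) :
    HasDerivAt (tiltRight ε δ a b) (tiltRight1 ε δ a a1 b b1 t) t :=
  hasDerivAt_shear ((hasDerivAt_ramp δ t).const_mul ε) hb (hasDerivAt_tiltLeft ha hb)

theorem hasDerivAt_tiltRight1 {t : ℝ} (ha : HasDerivAt a (a1 t) t) (ha1 : HasDerivAt a1 (a2 t) t)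
    (hb : HasDerivAt b (b1 t) t) (hb1 : HasDerivAt b1 (b2 t) t) :
    HasDerivAt (tiltRight1 ε δ a a1 b b1) (tiltRight2 ε δ a a1 a2 b b1 b2 t) t :=
  hasDerivAt_shear1 ((hasDerivAt_ramp δ t).const_mul ε) ((hasDerivAt_ramp1 δ t).const_mul ε)
    hb1 (hasDerivAt_tiltLeft ha hb) (hasDerivAt_tiltLeft1 ha1 hb hb1)

theorem hex_tilt_of_bump_eq_zero {t : ℝ} (h : bump δ t = 0) (j : Fin 6) :
    hex (tiltLeft ε δ a b) (tiltRight ε δ a b) j t = hex a b j t := by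
  simp [hex, tiltLeft, tiltRight, shear, ramp, h]

theorem hex_tilt1_of_bump_eq_zero {t : ℝ} (h : bump δ t = 0) (h1 : bump1 δ t = 0) (j : Fin 6) :
    hex (tiltLeft1 ε δ a1 b b1) (tiltRight1 ε δ a a1 b b1) j t = hex a1 b1 j t := by
  simp [hex, tiltLeft1, tiltRight1, shear1, ramp, ramp1, h, h1]

theorem hex_tilt_zero (j : Fin 6) :
    hex (tiltLeft 0 δ a b) (tiltRight 0 δ a b) j = hex a b j := by
  funext t; simp [hex, tiltLeft, tiltRight, shear]

theorem hex_tilt1_zero (j : Fin 6) :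
    hex (tiltLeft1 0 δ a1 b b1) (tiltRight1 0 δ a a1 b b1) j = hex a1 b1 j := by
  funext t; simp [hex, tiltLeft1, tiltRight1, shear1]

theorem hex_tilt2_zero (j : Fin 6) :
    hex (tiltLeft2 0 δ a2 b b1 b2) (tiltRight2 0 δ a a1 a2 b b1 b2) j = hex a2 b2 j := by
  funext t; simp [hex, tiltLeft2, tiltRight2, shear2]

theorem continuous_hex_tilt (ha : Continuous a) (hb : Continuous b) (j : Fin 6) :
    Continuous fun q : ℝ × ℝ => hex (tiltLeft q.1 δ a b) (tiltRight q.1 δ a b) j q.2 := by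
  have := continuous_bump δ
  have := continuous_ramp δ
  simp only [hex, tiltLeft, tiltRight, shear]
  fun_prop

theorem continuous_hex_tilt1 (ha : Continuous a) (ha1 : Continuous a1) (hb : Continuous b)
    (hb1 : Continuous b1) (j : Fin 6) : Continuous fun q : ℝ × ℝ =>
      hex (tiltLeft1 q.1 δ a1 b b1) (tiltRight1 q.1 δ a a1 b b1) j q.2 := by
  have := continuous_bump δ
  have := continuous_ramp δ
  have := continuous_bump1 δ
  have := continuous_ramp1 δ
  simp only [hex, tiltLeft, tiltLeft1, tiltRight1, shear, shear1]
  fun_prop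

theorem continuous_hex_tilt2 (ha : Continuous a) (ha1 : Continuous a1) (ha2 : Continuous a2)
    (hb : Continuous b) (hb1 : Continuous b1) (hb2 : Continuous b2) (j : Fin 6) :
    Continuous fun q : ℝ × ℝ =>
      hex (tiltLeft2 q.1 δ a2 b b1 b2) (tiltRight2 q.1 δ a a1 a2 b b1 b2) j q.2 := by
  have := continuous_bump δ
  have := continuous_ramp δ
  have := continuous_bump1 δ
  have := continuous_ramp1 δ
  have := continuous_bump2 δ
  have := continuous_ramp2 δ
  simp only [hex, tiltLeft, tiltLeft1, tiltLeft2, tiltRight2, shear, shear1, shear2]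
  fun_prop

end Tilt

/-- There is an area-decreasing surgery on a convex body with a hexagonal system of boundary
curves. -/
theorem IsHexCurve.exists_surgery {K : Set (ℝ × ℝ)} {c : ℝ} {a a1 a2 b b1 b2 : ℝ → ℝ × ℝ}
    (h : IsHexCurve K c a a1 a2 b b1 b2) (hK : IsCSCD K) (hpos : 0 < wedge (a 0) (a1 0)) :
    ∃ ε δ, Surgery K (hex a b) (hex a1 b1) (hex a2 b2) (hex (tiltLeft ε δ a b) (tiltRight ε δ a b))
        (hex (tiltLeft1 ε δ a1 b b1) (tiltRight1 ε δ a a1 b b1))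
        (hex (tiltLeft2 ε δ a2 b b1 b2) (tiltRight2 ε δ a a1 a2 b b1 b2)) 0 δ ∧
      ∫ t in (0 : ℝ)..δ, sweep (tiltLeft ε δ a b) (tiltLeft1 ε δ a1 b b1) (tiltRight ε δ a b)
        (tiltRight1 ε δ a a1 b b1) t < ∫ t in (0 : ℝ)..δ, sweep a a1 b b1 t := by
  obtain ⟨δ₀, hδ₀, hwin⟩ := h.exists_window hK hpos
  obtain ⟨δ, hδ, hδδ₀, hneg⟩ := h.exists_tilt hδ₀
  have hsub : Set.Icc 0 δ ⊆ Set.Icc 0 δ₀ := Set.Icc_subset_Icc_right hδδ₀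
  have hw : ∀ τ ∈ Set.Icc 0 δ, ∀ t ∈ Set.Icc 0 δ, ∀ s ∈ Set.Icc 0 δ, ∀ i,
      0 < wedge (hex a1 b1 i τ) (hex a2 b2 i t) ∧ 0 < wedge (hex a1 b1 i τ) (-hex a b i s) ∧
      ∀ j, i ≠ j → 0 < wedge (hex a1 b1 i τ) (hex a b j t - hex a b i s) :=
    fun τ hτ t ht s hs => hwin τ (hsub hτ) t (hsub ht) s (hsub hs)
  have c0 : ∀ j, Continuous (hex a b j) := continuous_hex h.continuous_left h.continuous_right
  have c1 : ∀ j, Continuous (hex a1 b1 j) :=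
    continuous_hex h.continuous_left' h.continuous_right'
  have C0 := fun j => continuous_hex_tilt (δ := δ) h.continuous_left h.continuous_right j
  have C1 := fun j => continuous_hex_tilt1 (δ := δ) h.continuous_left h.continuous_left'
    h.continuous_right h.continuous_right' j
  have C2 := fun j => continuous_hex_tilt2 (δ := δ) h.continuous_left h.continuous_left'
    h.cont_left h.continuous_right h.continuous_right' h.cont_right j
  have hev : ∀ᶠ ε in nhds (0 : ℝ), ∀ q ∈ Set.Icc 0 δ ×ˢ (Set.Icc 0 δ ×ˢ Set.Icc 0 δ), ∀ i,
      0 < wedge (hex (tiltLeft1 ε δ a1 b b1) (tiltRight1 ε δ a a1 b b1) i q.1)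
        (hex (tiltLeft2 ε δ a2 b b1 b2) (tiltRight2 ε δ a a1 a2 b b1 b2) i q.2.1) ∧
      ∀ j, i ≠ j → 0 < wedge (hex a1 b1 i q.1)
        (hex (tiltLeft ε δ a b) (tiltRight ε δ a b) j q.2.1 - hex a b i q.2.2) := by
    refine IsCompact.eventually_forall_of_forall_eventually
      (isCompact_Icc.prod (isCompact_Icc.prod isCompact_Icc)) fun q hq => Filter.eventually_all.2 fun i => ?_
    have hq' := hw q.1 hq.1 q.2.1 hq.2.1 q.2.2 hq.2.2 i
    refine Filter.Eventually.and ?_ (Filter.eventually_all.2 fun j => ?_)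
    · have hc : Continuous fun z : ℝ × ℝ × ℝ × ℝ =>
          wedge (hex (tiltLeft1 z.1 δ a1 b b1) (tiltRight1 z.1 δ a a1 b b1) i z.2.1)
            (hex (tiltLeft2 z.1 δ a2 b b1 b2) (tiltRight2 z.1 δ a a1 a2 b b1 b2) i z.2.2.1) :=
        ((C1 i).comp (continuous_fst.prodMk (continuous_fst.comp continuous_snd))).wedge
          ((C2 i).comp (continuous_fst.prodMk
            (continuous_fst.comp (continuous_snd.comp continuous_snd))))
      refine hc.continuousAt.eventually (lt_mem_nhds ?_)
      simpa only [hex_tilt1_zero, hex_tilt2_zero] using hq'.1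
    · by_cases hij : i = j
      · exact Filter.Eventually.of_forall fun _ hne => absurd hij hne
      · have hc : Continuous fun z : ℝ × ℝ × ℝ × ℝ => wedge (hex a1 b1 i z.2.1)
            (hex (tiltLeft z.1 δ a b) (tiltRight z.1 δ a b) j z.2.2.1 - hex a b i z.2.2.2) :=
          ((c1 i).comp (continuous_fst.comp continuous_snd)).wedge
            (((C0 j).comp (continuous_fst.prodMk
              (continuous_fst.comp (continuous_snd.comp continuous_snd)))).sub
              ((c0 i).comp (continuous_snd.comp (continuous_snd.comp continuous_snd))))
        have h0 : 0 < wedge (hex a1 b1 i q.1)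
            (hex (tiltLeft 0 δ a b) (tiltRight 0 δ a b) j q.2.1 - hex a b i q.2.2) := by
          simpa only [hex_tilt_zero] using hq'.2.2 j hij
        filter_upwards [hc.continuousAt (x := ((0 : ℝ), q)) |>.eventually (lt_mem_nhds h0)]
          with z hz _ using hz
  obtain ⟨η, hη, hball⟩ := Metric.eventually_nhds_iff.1 hev
  obtain ⟨ε, hε, hlt⟩ := hneg η hη
  have hε' := hball (y := ε) (by simpa using hε)
  have hl : (0 : ℝ) ∈ Set.Icc 0 δ := ⟨le_rfl, hδ.le⟩
  have hX0 : bump δ 0 = 0 := by simp [bump]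
  have hXδ : bump δ δ = 0 := by simp [bump]
  have hX0' : bump1 δ 0 = 0 := by simp [bump1]
  have hXδ' : bump1 δ δ = 0 := by simp [bump1]
  have hbc := fun j => h.isBoundaryCurve hK j
  refine ⟨ε, δ, ?_, hlt⟩
  exact
    { convex := hK.1
      isCompact := hK.2.1
      zero_mem := hK.zero_mem_interior
      arc := fun j => ⟨hδ, (hbc j).hasDerivAt, (hbc j).hasDerivAt',
        fun t ht τ hτ => (hw t ht τ hτ 0 hl j).1⟩
      arc' := fun j => ⟨hδ,
        fun t => hasDerivAt_hex (hasDerivAt_tiltLeft (h.left.hasDerivAt t) (h.right.hasDerivAt t))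
          (hasDerivAt_tiltRight (h.left.hasDerivAt t) (h.right.hasDerivAt t)) j,
        fun t => hasDerivAt_hex (hasDerivAt_tiltLeft1 (h.left.hasDerivAt' t) (h.right.hasDerivAt t)
          (h.right.hasDerivAt' t)) (hasDerivAt_tiltRight1 (h.left.hasDerivAt t)
          (h.left.hasDerivAt' t) (h.right.hasDerivAt t) (h.right.hasDerivAt' t)) j,
        fun t ht τ hτ => (hε' (t, τ, 0) ⟨ht, hτ, hl⟩ j).1⟩
      left_eq := hex_tilt_of_bump_eq_zero hX0
      right_eq := hex_tilt_of_bump_eq_zero hXδ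
      left_eq' := hex_tilt1_of_bump_eq_zero hX0 hX0'
      right_eq' := hex_tilt1_of_bump_eq_zero hXδ hXδ'
      mem := fun j t _ => (hbc j).mem hK t
      support := fun j t ht p hp => by
        have hκ : 0 < wedge (hex a b j t) (hex a1 b1 j t) := by
          have := (hw t ht t ht t ht j).2.1
          rwa [wedge_neg_right, ← wedge_swap] at this
        exact nonneg_of_mul_nonneg_right (((hbc j).support hK t).2 p hp) hκ
      sep := fun i j hij τ hτ t ht s hs => (hw τ hτ t ht s hs i).2.2 j hij
      sep' := fun i j hij τ hτ t ht s hs => (hε' (τ, t, s) ⟨hτ, ht, hs⟩ i).2 j hij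
      sep_zero := fun i τ hτ s hs => (hw τ hτ s hs s hs i).2.1 }

theorem IsArc.volume_cap_ne_top {g g1 g2 : ℝ → ℝ × ℝ} {s₀ s₁ : ℝ} (h : IsArc g g1 g2 s₀ s₁) :
    volume (cap g g1 s₀ s₁) ≠ ⊤ :=
  h.isCompact_cap.measure_ne_top

theorem IsArc.toReal_volume_cap {g g1 g2 : ℝ → ℝ × ℝ} {s₀ s₁ : ℝ} (h : IsArc g g1 g2 s₀ s₁) :
    (volume (cap g g1 s₀ s₁)).toReal =
      1 / 2 * (∫ t in s₀..s₁, wedge (g t) (g1 t)) - 1 / 2 * wedge (g s₀) (g s₁ - g s₀) := by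
  have hint : ∫ t in s₀..s₁, wedge (g s₀) (g1 t) = wedge (g s₀) (g s₁ - g s₀) := by
    rw [intervalIntegral.integral_eq_sub_of_hasDerivAt
      (fun t _ => (h.hasDerivAt t).const_wedge (g s₀))
      ((continuous_const.wedge h.continuous').intervalIntegrable _ _), wedge_sub_right]
  have hnn : 0 ≤ ∫ t in s₀..s₁, wedge (g t - g s₀) (g1 t) :=
    intervalIntegral.integral_nonneg h.lt.le fun t ht => by
      have := h.tangent_nonneg ht h.left_mem
      rw [wedge_swap, ← wedge_neg_left, neg_sub] at this
      exact this
  rw [h.volume_cap, ENNReal.toReal_ofReal (by positivity)]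
  simp only [wedge_sub_left]
  rw [intervalIntegral.integral_sub ((h.continuous.wedge h.continuous').intervalIntegrable _ _)
    ((continuous_const.wedge h.continuous').intervalIntegrable _ _), hint]
  ring

theorem sum_toReal_volume_cap_hex {a a1 b b1 : ℝ → ℝ × ℝ} {g2 : Fin 6 → ℝ → ℝ × ℝ} {s₀ s₁ : ℝ}
    (h : ∀ j, IsArc (hex a b j) (hex a1 b1 j) (g2 j) s₀ s₁) :
    ∑ j, (volume (cap (hex a b j) (hex a1 b1 j) s₀ s₁)).toReal =
      (∫ t in s₀..s₁, sweep a a1 b b1 t)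
        - 1 / 2 * ∑ j, wedge (hex a b j s₀) (hex a b j s₁ - hex a b j s₀) := by
  simp only [fun j => (h j).toReal_volume_cap, Finset.sum_sub_distrib, ← Finset.mul_sum]
  congr 1
  rw [← intervalIntegral.integral_finsetSum fun j _ =>
    ((h j).continuous.wedge (h j).continuous').intervalIntegrable _ _,
    ← intervalIntegral.integral_const_mul]
  congr 1
  funext t
  simp [Fin.sum_univ_succ, hex, hexLeft, hexRight, sweep, wedge]
  ring

theorem Surgery.toReal_volume_body {ι : Type*} [Fintype ι] {K : Set (ℝ × ℝ)}
    {g g1 g2 h h1 h2 : ι → ℝ → ℝ × ℝ} {s₀ s₁ : ℝ} (S : Surgery K g g1 g2 h h1 h2 s₀ s₁) :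
    (volume (Surgery.body K g h h1 s₀ s₁)).toReal + ∑ j, (volume (cap (g j) (g1 j) s₀ s₁)).toReal =
      (volume K).toReal + ∑ j, (volume (cap (h j) (h1 j) s₀ s₁)).toReal := by
  have hg := fun j => (S.arc j).volume_cap_ne_top
  have hh := fun j => (S.arc' j).volume_cap_ne_top
  rw [← ENNReal.toReal_sum fun j _ => hg j, ← ENNReal.toReal_sum fun j _ => hh j,
    ← ENNReal.toReal_add S.isCompact_body.measure_ne_top (ENNReal.sum_ne_top.2 fun j _ => hg j),
    ← ENNReal.toReal_add S.isCompact.measure_ne_top (ENNReal.sum_ne_top.2 fun j _ => hh j),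
    S.volume_body]

/-- An inscribed hexagon through a given boundary point is at least as large as any other affine
regular hexagon with this vertex contained in the body. -/
theorem IsCSCD.wedge_le_of_vertex {K : Set (ℝ × ℝ)} (hK : IsCSCD K) {v p u q : ℝ × ℝ}
    (hv : v ∈ K) (hp : p ∈ K) (hpv : p + v ∈ K) (hu : u ∈ frontier K) (hq : q ∈ frontier K)
    (hqu : q + u ∈ frontier K) (hw : 0 < wedge u q) (h : u = v ∨ q = v ∨ q + u = v) :
    wedge v p ≤ wedge u q := by
  rcases h with rfl | rfl | rfl
  · exact hK.wedge_le_of_hexagon hv hp hpv hq hqu hw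
  · have e : wedge q (-(q + u)) = wedge u q := by simp [wedge]; ring
    have := hK.wedge_le_of_hexagon hv hp hpv (hK.neg_mem_frontier hqu)
      (by convert hK.neg_mem_frontier hu using 1; abel) (by rwa [e])
    rwa [e] at this
  · have e : wedge (q + u) (-u) = wedge u q := by simp [wedge]; ring
    have := hK.wedge_le_of_hexagon hv hp hpv (hK.neg_mem_frontier hu)
      (by convert hq using 1; abel) (by rwa [e])
    rwa [e] at this

theorem IsHexCurve.exists_deltaLat_lt {K : Set (ℝ × ℝ)} {c : ℝ} {a a1 a2 b b1 b2 : ℝ → ℝ × ℝ}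
    (h : IsHexCurve K c a a1 a2 b b1 b2) (hK : IsCSCD K) (hpos : 0 < wedge (a 0) (a1 0)) :
    ∃ K', IsCSCD K' ∧ deltaLat K' < deltaLat K := by
  obtain ⟨ε, δ, S, hlt⟩ := h.exists_surgery hK hpos
  have hK' := S.isCSCD_body hK (fun j => j + 3) (by decide)
    (fun j t => congrFun (hex_add_three _ _ j) t) (fun j t => congrFun (hex_add_three _ _ j) t)
    (fun j t => congrFun (hex_add_three _ _ j) t)
  have hbase : Admissible K (a 0) (b 0) := by
    refine hK.admissible_of_hexagon (h.left.mem_frontier 0) (h.right.mem_frontier 0) ?_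
      (by rw [h.wedge_eq]; exact h.pos.ne')
    rw [add_comm]
    exact h.add.mem_frontier 0
  refine ⟨_, hK', deltaLat_lt_deltaLat hK hK' ⟨_, _, hbase⟩ ?_ fun v w hvw => ?_⟩
  · have hv := S.toReal_volume_body
    rw [sum_toReal_volume_cap_hex S.arc, sum_toReal_volume_cap_hex S.arc'] at hv
    simp only [S.left_eq, S.right_eq] at hv
    linarith
  · obtain ⟨u, hu, q, hq, hqu, hw, hle⟩ := hK'.exists_hexagon hvw
    by_cases hold : u ∈ frontier K ∧ q ∈ frontier K ∧ q + u ∈ frontier K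
    · exact ⟨u, q, hK.admissible_of_hexagon hold.1 hold.2.1 hold.2.2 hw.ne',
        by rwa [abs_of_pos hw]⟩
    · refine ⟨a 0, b 0, hbase, ?_⟩
      rw [h.wedge_eq, abs_of_pos h.pos]
      refine le_trans ?_ hle
      obtain ⟨j, t, ht, hv⟩ : ∃ j, ∃ t ∈ Set.Icc 0 δ,
          u = hex (tiltLeft ε δ a b) (tiltRight ε δ a b) j t ∨
          q = hex (tiltLeft ε δ a b) (tiltRight ε δ a b) j t ∨
          q + u = hex (tiltLeft ε δ a b) (tiltRight ε δ a b) j t := by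
        rcases S.frontier_body_subset hu with h1 | ⟨j, t, ht, h1⟩
        · rcases S.frontier_body_subset hq with h2 | ⟨j, t, ht, h2⟩
          · rcases S.frontier_body_subset hqu with h3 | ⟨j, t, ht, h3⟩
            · exact absurd ⟨h1, h2, h3⟩ hold
            · exact ⟨j, t, ht, Or.inr (Or.inr h3)⟩
          · exact ⟨j, t, ht, Or.inr (Or.inl h2)⟩
        · exact ⟨j, t, ht, Or.inl h1⟩
      have hmem := fun j => Surgery.cap_subset_body (K := K) (g := hex a b) j
        ((S.arc' j).mem_cap ht)
      have := hK'.wedge_le_of_vertex (hmem j) (hmem (j + 2))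
        (by rw [hex_add_hex]; exact hmem (j + 1)) hu hq hqu hw hv
      rwa [wedge_hex, wedge_tilt, h.wedge_eq] at this

/-- A diffeomorphism from the real line to the open interval `(t₀, t₁)`. -/
def stretch (t₀ t₁ s : ℝ) : ℝ := (t₀ + t₁) / 2 + (t₁ - t₀) / Real.pi * Real.arctan s

theorem stretch_mem {t₀ t₁ : ℝ} (ht : t₀ < t₁) (s : ℝ) : stretch t₀ t₁ s ∈ Set.Ioo t₀ t₁ := by
  have hr : 0 < (t₁ - t₀) / Real.pi := div_pos (sub_pos.2 ht) Real.pi_pos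
  have h1 := mul_lt_mul_of_pos_left (Real.neg_pi_div_two_lt_arctan s) hr
  have h2 := mul_lt_mul_of_pos_left (Real.arctan_lt_pi_div_two s) hr
  have e : (t₁ - t₀) / Real.pi * (Real.pi / 2) = (t₁ - t₀) / 2 := by
    field_simp
  rw [mul_neg, e] at h1
  rw [e] at h2
  constructor <;> unfold stretch <;> linarith

theorem exists_isBoundaryCurve {K : Set (ℝ × ℝ)} {t₀ t₁ : ℝ} (ht : t₀ < t₁) {σ : ℝ → ℝ × ℝ}
    (hσ : ContDiffOn ℝ 2 σ (Set.Icc t₀ t₁)) (hfr : ∀ t ∈ Set.Icc t₀ t₁, σ t ∈ frontier K)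
    (hcurv : ∀ t ∈ Set.Ioo t₀ t₁, wedge (deriv σ t) (deriv (deriv σ) t) ≠ 0) :
    ∃ γ1 γ2, IsBoundaryCurve K (fun s => σ (stretch t₀ t₁ s)) γ1 γ2 ∧ Continuous γ2 := by
  have hσ0 : ContDiffOn ℝ (1 + 1) σ (Set.Ioo t₀ t₁) :=
    (hσ.mono Set.Ioo_subset_Icc_self).of_le (by norm_num)
  have hσ1 : ContDiffOn ℝ (0 + 1) (deriv σ) (Set.Ioo t₀ t₁) :=
    ((contDiffOn_succ_iff_deriv_of_isOpen isOpen_Ioo).1 hσ0).2.2.of_le (by norm_num)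
  have hσ2 : ContinuousOn (deriv (deriv σ)) (Set.Ioo t₀ t₁) :=
    ((contDiffOn_succ_iff_deriv_of_isOpen isOpen_Ioo).1 hσ1).2.2.continuousOn
  have hd0 : ∀ t ∈ Set.Ioo t₀ t₁, HasDerivAt σ (deriv σ t) t := fun t h =>
    ((hσ0.differentiableOn (by norm_num)).differentiableAt (isOpen_Ioo.mem_nhds h)).hasDerivAt
  have hd1 : ∀ t ∈ Set.Ioo t₀ t₁, HasDerivAt (deriv σ) (deriv (deriv σ) t) t := fun t h =>
    ((hσ1.differentiableOn (by norm_num)).differentiableAt (isOpen_Ioo.mem_nhds h)).hasDerivAt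
  set φ := stretch t₀ t₁ with hφ
  have hmem : ∀ s, φ s ∈ Set.Ioo t₀ t₁ := stretch_mem ht
  set r := (t₁ - t₀) / Real.pi with hr
  have hr0 : 0 < r := div_pos (sub_pos.2 ht) Real.pi_pos
  have hpos : ∀ s : ℝ, 0 < 1 + s ^ 2 := fun s => by positivity
  have hφ0 : ∀ s, HasDerivAt φ (r / (1 + s ^ 2)) s := fun s =>
    (((Real.hasDerivAt_arctan s).const_mul r).const_add ((t₀ + t₁) / 2)).congr_deriv
      (by rw [mul_one_div])
  have hφ1 : ∀ s, HasDerivAt (fun s : ℝ => r / (1 + s ^ 2))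
      (-(r * (2 * s)) / (1 + s ^ 2) ^ 2) s := fun s =>
    ((hasDerivAt_const s r).div (((hasDerivAt_id s).pow 2).const_add 1) (hpos s).ne').congr_deriv
      (by simp)
  have hφc : Continuous φ := continuous_iff_continuousAt.2 fun s => (hφ0 s).continuousAt
  have hc1 : Continuous fun s => deriv σ (φ s) :=
    hσ1.continuousOn.comp_continuous hφc hmem
  have hc2 : Continuous fun s => deriv (deriv σ) (φ s) := hσ2.comp_continuous hφc hmem
  refine ⟨fun s => (r / (1 + s ^ 2)) • deriv σ (φ s),
    fun s => (-(r * (2 * s)) / (1 + s ^ 2) ^ 2) • deriv σ (φ s)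
      + (r / (1 + s ^ 2)) ^ 2 • deriv (deriv σ) (φ s), ⟨fun s => ?_, fun s => ?_, fun s => ?_,
      fun s => ?_⟩, ?_⟩
  · exact (hd0 _ (hmem s)).scomp s (hφ0 s)
  · refine ((hφ1 s).smul ((hd1 _ (hmem s)).scomp s (hφ0 s))).congr_deriv ?_
    simp only [Function.comp_apply]
    module
  · exact hfr _ (Set.Ioo_subset_Icc_self (hmem s))
  · have e : wedge ((r / (1 + s ^ 2)) • deriv σ (φ s))
        ((-(r * (2 * s)) / (1 + s ^ 2) ^ 2) • deriv σ (φ s)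
          + (r / (1 + s ^ 2)) ^ 2 • deriv (deriv σ) (φ s)) =
        (r / (1 + s ^ 2)) ^ 3 * wedge (deriv σ (φ s)) (deriv (deriv σ) (φ s)) := by
      simp only [wedge_add_right, wedge_smul_left, wedge_smul_right, wedge_self]
      ring
    rw [e]
    exact mul_ne_zero (pow_ne_zero 3 (div_pos hr0 (hpos s)).ne') (hcurv _ (hmem s))
  · have h1 : Continuous fun s : ℝ => r / (1 + s ^ 2) :=
      continuous_const.div (by fun_prop) fun s => (hpos s).ne'
    have h2 : Continuous fun s : ℝ => -(r * (2 * s)) / (1 + s ^ 2) ^ 2 :=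
      Continuous.div (by fun_prop) (by fun_prop) fun s => (pow_pos (hpos s) 2).ne'
    fun_prop

theorem IsBoundaryCurve.congr {K : Set (ℝ × ℝ)} {γ γ1 γ2 η η1 η2 : ℝ → ℝ × ℝ}
    (h : IsBoundaryCurve K γ γ1 γ2) (e : γ = η) (h1 : ∀ t, HasDerivAt η (η1 t) t)
    (h2 : ∀ t, HasDerivAt η1 (η2 t) t) : IsBoundaryCurve K η η1 η2 := by
  subst e
  obtain rfl : γ1 = η1 := funext fun t => (h.hasDerivAt t).unique (h1 t)
  obtain rfl : γ2 = η2 := funext fun t => (h.hasDerivAt' t).unique (h2 t)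
  exact h

theorem IsHexCurve.exists_deltaLat_lt' {K : Set (ℝ × ℝ)} {c : ℝ} {a a1 a2 b b1 b2 : ℝ → ℝ × ℝ}
    (h : IsHexCurve K c a a1 a2 b b1 b2) (hK : IsCSCD K) :
    ∃ K', IsCSCD K' ∧ deltaLat K' < deltaLat K := by
  rcases lt_or_gt_of_ne (h.left.support hK 0).1 with h0 | h0
  · refine h.reverse.exists_deltaLat_lt hK ?_
    rw [neg_zero, wedge_neg_right]
    linarith
  · exact h.exists_deltaLat_lt hK h0

/-- No segment of the boundary of a miserly domain is parametrized by a
multi-curve of rank three (all components with nonvanishing curvature). -/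
theorem no_rank_three_on_miserly_boundary (K : Set (ℝ × ℝ)) (hK : IsMiserly K)
    (t₀ t₁ : ℝ) (ht : t₀ < t₁) (σ : ZMod 6 → ℝ → ℝ × ℝ) :
    ¬ (IsMultiCurve σ t₀ t₁ ∧
       (∀ j, ContDiffOn ℝ 2 (σ j) (Set.Icc t₀ t₁)) ∧
       (∀ j, Set.InjOn (σ j) (Set.Icc t₀ t₁)) ∧
       (∀ j, ∀ t ∈ Set.Icc t₀ t₁, derivWithin (σ j) (Set.Icc t₀ t₁) t ≠ 0) ∧
       (∀ j, ∀ t ∈ Set.Icc t₀ t₁, σ j t ∈ frontier K) ∧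
       (∀ j, ∀ t ∈ Set.Ioo t₀ t₁,
          wedge (deriv (σ j) t) (deriv (deriv (σ j)) t) ≠ 0)) := by
  rintro ⟨⟨-, hσ⟩, hC2, -, -, hfr, hcurv⟩
  have hcurve := fun j => exists_isBoundaryCurve ht (hC2 j) (hfr j) (hcurv j)
  obtain ⟨a1, a2, ha, ca⟩ := hcurve 0
  obtain ⟨b1, b2, hb, cb⟩ := hcurve 2
  obtain ⟨d1, d2, hd, -⟩ := hcurve 1
  have hmem := fun s => Set.Ioo_subset_Icc_self (stretch_mem ht s)
  have hsum : (fun s => σ 1 (stretch t₀ t₁ s)) =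
      (fun s => σ 0 (stretch t₀ t₁ s)) + fun s => σ 2 (stretch t₀ t₁ s) := by
    funext s
    have h0 := (hσ _ (hmem s) 0).1
    have h1 := (hσ _ (hmem s) 1).2.1
    rw [show (1 : ZMod 6) + 3 = 4 by decide] at h1
    simp only [zero_add] at h0 h1
    rw [h1, add_neg_eq_zero] at h0
    exact h0.symm
  have h : IsHexCurve K (Real.sqrt 3 / 2) _ a1 a2 _ b1 b2 :=
    { pos := by positivity
      wedge_eq := fun s => by simpa using (hσ _ (hmem s) 0).2.2
      left := ha
      right := hb
      add := hd.congr hsum (fun t => (ha.hasDerivAt t).add (hb.hasDerivAt t))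
        fun t => (ha.hasDerivAt' t).add (hb.hasDerivAt' t)
      cont_left := ca
      cont_right := cb }
  obtain ⟨K', hK', hlt⟩ := h.exists_deltaLat_lt' hK.1
  exact absurd (hK.2 K' hK') (not_le.2 hlt)
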